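/- arXiv:2502.02064 — 2 statements merged into one kernel-verified Lean document; each statement's English description precedes it below -/
import Mathlib

section
/- Let φ : ℝ⁺ → ℝ⁺ be an increasing function such that log φ is a regularly increasing function with index ρ, where 0 ≤ ρ < 1/2. Then the Hausdorff dimension of L(φ) equals 1. -/
open Filter Set
open scoped ENNReal

/-- The Gauss map. -/
noncomputable def gaussMap (x : ℝ) : ℝ := Int.fract (1 / x)

/-- The `n`-th partial quotient `a_n(x)` (for `n ≥ 1`) of the continued fraction
expansion of `x ∈ (0,1)`. -/
noncomputable def pq (x : ℝ) (n : ℕ) : ℕ := ⌊1 / (gaussMap^[n - 1] x)⌋₊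

/-- `L_n(x) = max_{1 ≤ i ≤ n} a_i(x) a_{i+1}(x)`. -/
noncomputable def Lmax (x : ℝ) (n : ℕ) : ℕ :=
  (Finset.Icc 1 n).sup fun i => pq x i * pq x (i + 1)

/-- The level set `L(φ)` of irrational `x ∈ (0,1)` with `L_n(x)/φ(n) → 1`. -/
def Lset (φ : ℕ → ℝ) : Set ℝ :=
  {x | x ∈ Ioo (0 : ℝ) 1 ∧ Irrational x ∧
    Tendsto (fun n => (Lmax x n : ℝ) / φ n) atTop (nhds 1)}

/-- `f` is regularly increasing with (finite) index `ρ`. -/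
def RegInc (f : ℝ → ℝ) (ρ : ℝ) : Prop :=
  ∃ c > (0 : ℝ), ∃ f' : ℝ → ℝ,
    (∀ x ∈ Ici c, 0 < f x) ∧
    (∀ x ∈ Ici c, HasDerivAt f (f' x) x) ∧
    ContinuousOn f' (Ici c) ∧
    (∀ x ∈ Ici c, 0 < f' x) ∧
    Tendsto f atTop atTop ∧
    Tendsto (fun x => x * f' x / f x) atTop (nhds ρ)

/-- `f` is regularly increasing with index `∞`. -/
def RegIncTop (f : ℝ → ℝ) : Prop :=
  ∃ c > (0 : ℝ), ∃ f' : ℝ → ℝ,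
    (∀ x ∈ Ici c, 0 < f x) ∧
    (∀ x ∈ Ici c, HasDerivAt f (f' x) x) ∧
    ContinuousOn f' (Ici c) ∧
    (∀ x ∈ Ici c, 0 < f' x) ∧
    Tendsto f atTop atTop ∧
    Tendsto (fun x => x * f' x / f x) atTop atTop

/-- The `n`-th truncation of the continued fraction with partial quotients `d`. -/
noncomputable def cfTrunc : ℕ → (ℕ → ℕ) → ℝ
  | 0, _ => 0
  | n + 1, d => 1 / (d 0 + cfTrunc n fun i => d (i + 1))

lemma cfTrunc_mem_Icc {d : ℕ → ℕ} (hd : ∀ n, 1 ≤ d n) (n : ℕ) : cfTrunc n d ∈ Icc (0 : ℝ) 1 := by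
  induction n generalizing d with
  | zero => simp [cfTrunc]
  | succ n ih =>
    have h := ih (d := fun i => d (i + 1)) fun i => hd _
    have h0 : (1 : ℝ) ≤ d 0 := by exact_mod_cast hd 0
    have h1 : (1 : ℝ) ≤ d 0 + cfTrunc n fun i => d (i + 1) := by linarith [h.1]
    rw [cfTrunc]
    exact ⟨by positivity, by rw [div_le_one (by linarith)]; exact h1⟩

lemma abs_cf_two_step_le {a b x y : ℝ} (ha : 1 ≤ a) (hb : 1 ≤ b) (hx : 0 ≤ x) (hy : 0 ≤ y) :
    |1 / (a + 1 / (b + x)) - 1 / (a + 1 / (b + y))| ≤ |x - y| / 4 := by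
  have hX : 2 ≤ a * (b + x) + 1 := by nlinarith
  have hY : 2 ≤ a * (b + y) + 1 := by nlinarith
  have e : 1 / (a + 1 / (b + x)) - 1 / (a + 1 / (b + y))
      = (x - y) / ((a * (b + x) + 1) * (a * (b + y) + 1)) := by
    have : b + x ≠ 0 := by positivity
    have : b + y ≠ 0 := by positivity
    have : a * (b + x) + 1 ≠ 0 := by positivity
    have : a * (b + y) + 1 ≠ 0 := by positivity
    field_simp
    ring
  have hP : 4 ≤ (a * (b + x) + 1) * (a * (b + y) + 1) := by nlinarith
  rw [e, abs_div, abs_of_pos (by linarith : 0 < (a * (b + x) + 1) * (a * (b + y) + 1))]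
  exact div_le_div_of_nonneg_left (abs_nonneg _) (by norm_num) hP

lemma dist_cfTrunc_le {d : ℕ → ℕ} (hd : ∀ n, 1 ≤ d n) (n : ℕ) :
    dist (cfTrunc n d) (cfTrunc (n + 1) d) ≤ 2 * (1 / 2) ^ n := by
  induction n using Nat.strong_induction_on generalizing d with
  | _ n ih =>
    match n, ih with
    | 0, _ =>
      refine (Real.dist_le_of_mem_Icc_01 (cfTrunc_mem_Icc hd _) (cfTrunc_mem_Icc hd _)).trans ?_
      norm_num
    | 1, _ =>
      refine (Real.dist_le_of_mem_Icc_01 (cfTrunc_mem_Icc hd _) (cfTrunc_mem_Icc hd _)).trans ?_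
      norm_num
    | n + 2, ih =>
      have h := ih n (by omega) (d := fun i => d (i + 1 + 1)) fun i => hd _
      have h0 : (1 : ℝ) ≤ d 0 := by exact_mod_cast hd 0
      have h1 : (1 : ℝ) ≤ d 1 := by exact_mod_cast hd 1
      have hs : ∀ m, cfTrunc (m + 2) d
          = 1 / (d 0 + 1 / (d 1 + cfTrunc m fun i => d (i + 1 + 1))) := fun m => rfl
      have hm : ∀ m, 0 ≤ cfTrunc m fun i => d (i + 1 + 1) :=
        fun m => (cfTrunc_mem_Icc (fun i => hd _) m).1
      rw [show n + 2 + 1 = n + 1 + 2 by ring, hs n, hs (n + 1), Real.dist_eq]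
      refine (abs_cf_two_step_le h0 h1 (hm _) (hm _)).trans ?_
      rw [Real.dist_eq] at h
      rw [pow_add]
      linarith

/-- Every sequence of positive integers is the sequence of partial quotients of a sequence of
complete quotients. -/
lemma exists_completeQuotients {d : ℕ → ℕ} (hd : ∀ n, 1 ≤ d n) :
    ∃ x : ℕ → ℝ, ∀ n, x n ∈ Ioo (0 : ℝ) 1 ∧ x n * (d n + x (n + 1)) = 1 := by
  have hlim : ∀ k, ∃ y, Tendsto (fun m => cfTrunc m fun i => d (i + k)) atTop (nhds y) := fun k =>
    cauchySeq_tendsto_of_complete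
      (cauchySeq_of_le_geometric _ _ (by norm_num) (dist_cfTrunc_le fun i => hd _))
  choose x hx using hlim
  have hx0 : ∀ k, 0 ≤ x k := fun k =>
    ge_of_tendsto' (hx k) fun m => (cfTrunc_mem_Icc (fun i => hd _) m).1
  have hd' : ∀ n, (1 : ℝ) ≤ d n := fun n => by exact_mod_cast hd n
  have hrec : ∀ k, x k = 1 / (d k + x (k + 1)) := fun k => by
    refine tendsto_nhds_unique ((tendsto_add_atTop_iff_nat 1).2 (hx k)) ?_
    have h := (tendsto_const_nhds (x := (1 : ℝ))).div ((hx (k + 1)).const_add (d k : ℝ))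
      (by linarith [hd' k, hx0 (k + 1)])
    refine h.congr fun m => ?_
    simp only [cfTrunc, zero_add, Pi.div_apply]
    simp only [add_assoc, add_comm 1 k]
  have hpos : ∀ k, 0 < x k := fun k => by
    rw [hrec k]
    have := hd' k
    have := hx0 (k + 1)
    positivity
  refine ⟨x, fun n => ⟨⟨hpos n, ?_⟩, ?_⟩⟩
  · rw [hrec n, div_lt_one (by linarith [hd' n, hpos (n + 1)])]
    linarith [hd' n, hpos (n + 1)]
  · rw [hrec n]
    exact one_div_mul_cancel (by linarith [hd' n, hpos (n + 1)])

section CompleteQuotients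

variable {d : ℕ → ℕ} {x : ℕ → ℝ}

lemma inv_eq_of_completeQuotients (hx : ∀ n, x n ∈ Ioo (0 : ℝ) 1 ∧ x n * (d n + x (n + 1)) = 1)
    (n : ℕ) : 1 / x n = d n + x (n + 1) := by
  rw [eq_comm, eq_div_iff (hx n).1.1.ne', mul_comm]
  exact (hx n).2

lemma gaussMap_iterate_eq (hx : ∀ n, x n ∈ Ioo (0 : ℝ) 1 ∧ x n * (d n + x (n + 1)) = 1)
    (n : ℕ) : gaussMap^[n] (x 0) = x n := by
  induction n with
  | zero => rfl
  | succ n ih =>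
    rw [Function.iterate_succ_apply', ih, gaussMap, inv_eq_of_completeQuotients hx n,
      Int.fract_natCast_add]
    exact Int.fract_eq_self.2 ⟨(hx _).1.1.le, (hx _).1.2⟩

lemma pq_succ_eq (hx : ∀ n, x n ∈ Ioo (0 : ℝ) 1 ∧ x n * (d n + x (n + 1)) = 1)
    (n : ℕ) : pq (x 0) (n + 1) = d n := by
  rw [pq, Nat.add_sub_cancel, gaussMap_iterate_eq hx, inv_eq_of_completeQuotients hx n,
    Nat.floor_eq_iff (by linarith [(hx (n + 1)).1.1, (d n).cast_nonneg (α := ℝ)])]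
  exact ⟨by linarith [(hx (n + 1)).1.1], by linarith [(hx (n + 1)).1.2]⟩

lemma completeQuotient_mul_ne (hx : ∀ n, x n ∈ Ioo (0 : ℝ) 1 ∧ x n * (d n + x (n + 1)) = 1)
    (b : ℕ) : ∀ (n : ℕ) (a : ℤ), 0 < b → x n * b ≠ a := by
  induction b using Nat.strong_induction_on with
  | _ b ih =>
    intro n a hb h
    have hb' : (0 : ℝ) < b := by exact_mod_cast hb
    have ha0 : (0 : ℝ) < a := by rw [← h]; exact mul_pos (hx n).1.1 hb'
    have hab : (a : ℝ) < b := by rw [← h]; nlinarith [(hx n).1.2]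
    obtain ⟨c, rfl⟩ := Int.eq_ofNat_of_zero_le (by exact_mod_cast ha0.le : 0 ≤ a)
    have hc : 0 < c := by exact_mod_cast ha0
    have hcb : c < b := by exact_mod_cast hab
    refine ih c hcb (n + 1) (b - d n * c) hc ?_
    push_cast at h ⊢
    linear_combination (b : ℝ) * (hx n).2 - (d n + x (n + 1)) * h

lemma irrational_of_completeQuotients
    (hx : ∀ n, x n ∈ Ioo (0 : ℝ) 1 ∧ x n * (d n + x (n + 1)) = 1) : Irrational (x 0) := by
  rintro ⟨r, hr⟩
  refine completeQuotient_mul_ne hx r.den 0 r.num r.den_pos ?_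
  rw [← hr]
  exact_mod_cast r.mul_den_eq_num

end CompleteQuotients

/-- The ratio of consecutive denominators of the convergents with partial quotients `d`. -/
noncomputable def denRatio (d : ℕ → ℕ) : ℕ → ℝ
  | 0 => 0
  | n + 1 => 1 / (d n + denRatio d n)

/-- The denominators of the convergents with partial quotients `d`. -/
noncomputable def den (d : ℕ → ℕ) : ℕ → ℝ
  | 0 => 1
  | n + 1 => den d n * (d n + denRatio d n)

/-- The reciprocal of the length of a fundamental interval. -/
noncomputable def invLen (d : ℕ → ℕ) (n : ℕ) : ℝ := den d n ^ 2 * (1 + denRatio d n)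

lemma denRatio_congr {d e : ℕ → ℕ} {n : ℕ} (h : ∀ i < n, d i = e i) :
    denRatio d n = denRatio e n := by
  induction n with
  | zero => rfl
  | succ n ih => rw [denRatio, denRatio, ih fun i hi => h i (by omega), h n (by omega)]

lemma den_congr {d e : ℕ → ℕ} {n : ℕ} (h : ∀ i < n, d i = e i) : den d n = den e n := by
  induction n with
  | zero => rfl
  | succ n ih =>
    have h' : ∀ i < n, d i = e i := fun i hi => h i (by omega)
    rw [den, den, ih h', denRatio_congr h', h n (by omega)]

section Denominators

variable {d : ℕ → ℕ}

lemma denRatio_mem_Icc (hd : ∀ n, 1 ≤ d n) (n : ℕ) : denRatio d n ∈ Icc (0 : ℝ) 1 := by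
  induction n with
  | zero => simp [denRatio]
  | succ n ih =>
    have h : (1 : ℝ) ≤ d n + denRatio d n := by
      have : (1 : ℝ) ≤ d n := by exact_mod_cast hd n
      linarith [ih.1]
    exact ⟨by rw [denRatio]; positivity, by rw [denRatio, div_le_one (by linarith)]; exact h⟩

lemma den_pos (hd : ∀ n, 1 ≤ d n) (n : ℕ) : 0 < den d n := by
  induction n with
  | zero => simp [den]
  | succ n ih =>
    have : (1 : ℝ) ≤ d n := by exact_mod_cast hd n
    have := (denRatio_mem_Icc hd n).1
    rw [den]
    positivity

lemma invLen_succ (hd : ∀ n, 1 ≤ d n) (n : ℕ) :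
    invLen d (n + 1) = invLen d n *
      ((d n + denRatio d n) * (d n + denRatio d n + 1) / (1 + denRatio d n)) := by
  have h1 : (1 : ℝ) ≤ d n := by exact_mod_cast hd n
  have h2 := (denRatio_mem_Icc hd n).1
  have : (d n : ℝ) + denRatio d n ≠ 0 := by positivity
  have : 1 + denRatio d n ≠ 0 := by positivity
  rw [invLen, invLen, den, denRatio]
  field_simp

lemma two_pow_le_invLen (hd : ∀ n, 1 ≤ d n) (n : ℕ) : 2 ^ n ≤ invLen d n := by
  induction n with
  | zero => simp [invLen, den, denRatio]
  | succ n ih =>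
    have h1 : (1 : ℝ) ≤ d n := by exact_mod_cast hd n
    have h2 := (denRatio_mem_Icc hd n).1
    have h3 : 2 ≤ (d n + denRatio d n) * (d n + denRatio d n + 1) / (1 + denRatio d n) := by
      rw [le_div_iff₀ (by linarith)]
      nlinarith
    rw [invLen_succ hd, pow_succ]
    exact mul_le_mul ih h3 (by norm_num) ((pow_nonneg (by norm_num) n).trans ih)

lemma invLen_pos (hd : ∀ n, 1 ≤ d n) (n : ℕ) : 0 < invLen d n :=
  (pow_pos (by norm_num) n).trans_le (two_pow_le_invLen hd n)

lemma prod_completeQuotients_mul (hd : ∀ n, 1 ≤ d n) {x : ℕ → ℝ}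
    (hx : ∀ n, x n ∈ Ioo (0 : ℝ) 1 ∧ x n * (d n + x (n + 1)) = 1) (n : ℕ) :
    (∏ i ∈ Finset.range n, x i) * (den d n * (1 + denRatio d n * x n)) = 1 := by
  induction n with
  | zero => simp [den, denRatio]
  | succ n ih =>
    have h1 : (1 : ℝ) ≤ d n := by exact_mod_cast hd n
    have h2 := (denRatio_mem_Icc hd n).1
    have h3 : (d n : ℝ) + denRatio d n ≠ 0 := by positivity
    have h4 : den d (n + 1) * (1 + denRatio d (n + 1) * x (n + 1))
        = den d n * (d n + denRatio d n + x (n + 1)) := by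
      rw [den, denRatio]
      field_simp
    rw [Finset.prod_range_succ, h4]
    linear_combination ih + (∏ i ∈ Finset.range n, x i) * den d n * (hx n).2

lemma one_le_prod_mul (hd : ∀ n, 1 ≤ d n) {x : ℕ → ℝ}
    (hx : ∀ n, x n ∈ Ioo (0 : ℝ) 1 ∧ x n * (d n + x (n + 1)) = 1) (n : ℕ) :
    1 ≤ (∏ i ∈ Finset.range n, x i) * (den d n * (1 + denRatio d n)) := by
  refine (prod_completeQuotients_mul hd hx n).symm.le.trans ?_
  have h1 := (denRatio_mem_Icc hd n).1
  have := (hx n).1.2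
  have := den_pos hd n
  have : 0 ≤ ∏ i ∈ Finset.range n, x i := Finset.prod_nonneg fun i _ => (hx i).1.1.le
  gcongr
  exact mul_le_of_le_one_right h1 (hx n).1.2.le

end Denominators

lemma abs_sub_eq_prod_mul {d e : ℕ → ℕ} {x y : ℕ → ℝ} {n : ℕ}
    (hx : ∀ n, x n ∈ Ioo (0 : ℝ) 1 ∧ x n * (d n + x (n + 1)) = 1)
    (hy : ∀ n, y n ∈ Ioo (0 : ℝ) 1 ∧ y n * (e n + y (n + 1)) = 1)
    (h : ∀ i < n, d i = e i) :
    |x 0 - y 0| = (∏ i ∈ Finset.range n, x i) * (∏ i ∈ Finset.range n, y i) * |x n - y n| := by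
  induction n with
  | zero => simp
  | succ n ih =>
    have h1 : |x n - y n| = x n * y n * |x (n + 1) - y (n + 1)| := by
      have hn : (d n : ℝ) = e n := by exact_mod_cast h n (by omega)
      have h2 : x n - y n = x n * y n * (y (n + 1) - x (n + 1)) := by
        linear_combination y n * (hx n).2 - x n * (hy n).2 - x n * y n * hn
      rw [h2, abs_mul, abs_of_pos (mul_pos (hx n).1.1 (hy n).1.1), abs_sub_comm]
    rw [ih fun i hi => h i (by omega), h1, Finset.prod_range_succ, Finset.prod_range_succ]
    ring

lemma abs_sub_le_invLen_mul {d e : ℕ → ℕ} {x y : ℕ → ℝ} {n : ℕ}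
    (hd : ∀ n, 1 ≤ d n) (he : ∀ n, 1 ≤ e n)
    (hx : ∀ n, x n ∈ Ioo (0 : ℝ) 1 ∧ x n * (d n + x (n + 1)) = 1)
    (hy : ∀ n, y n ∈ Ioo (0 : ℝ) 1 ∧ y n * (e n + y (n + 1)) = 1)
    (h : ∀ i < n, d i = e i) :
    |x n - y n| ≤ 2 * invLen d n * |x 0 - y 0| := by
  have h1 := one_le_prod_mul hd hx n
  have h2 := one_le_prod_mul he hy n
  rw [← den_congr h, ← denRatio_congr h] at h2
  have ht := denRatio_mem_Icc hd n
  have hP : 0 ≤ (∏ i ∈ Finset.range n, x i) * ∏ i ∈ Finset.range n, y i :=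
    mul_nonneg (Finset.prod_nonneg fun i _ => (hx i).1.1.le)
      (Finset.prod_nonneg fun i _ => (hy i).1.1.le)
  have h3 := mul_le_mul h1 h2 zero_le_one (zero_le_one.trans h1)
  have h4 : (1 : ℝ) ≤ 2 * invLen d n *
      ((∏ i ∈ Finset.range n, x i) * ∏ i ∈ Finset.range n, y i) := by
    rw [one_mul] at h3
    refine h3.trans ?_
    rw [invLen]
    have : 0 ≤ ((∏ i ∈ Finset.range n, x i) * ∏ i ∈ Finset.range n, y i) * den d n ^ 2
      * (1 + denRatio d n) := by
      have := ht.1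
      positivity
    nlinarith [ht.2]
  rw [abs_sub_eq_prod_mul hx hy h, ← mul_assoc]
  exact le_mul_of_one_le_left (abs_nonneg _) h4

/-- Complete quotients whose first partial quotients differ are separated. -/
lemma le_abs_sub_of_lt {a b : ℕ} {M : ℝ} {x y x' y' y'' : ℝ} {b' : ℕ} (hab : a < b)
    (hb : b ≤ M) (hb' : b' ≤ M) (hx : x * (a + x') = 1) (hy : y * (b + y') = 1)
    (hy' : y' * (b' + y'') = 1) (hx' : x' ∈ Ioo (0 : ℝ) 1) (hy0 : y' ∈ Ioo (0 : ℝ) 1)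
    (hy'' : y'' ∈ Ioo (0 : ℝ) 1) :
    1 / (M + 1) ^ 3 ≤ |x - y| := by
  have hM : 0 ≤ M := b.cast_nonneg.trans hb
  have hab' : (a : ℝ) + 1 ≤ b := by exact_mod_cast hab
  have ha0 : (0 : ℝ) ≤ a := a.cast_nonneg
  have hX : 0 < (a : ℝ) + x' := by linarith [hx'.1]
  have hY : 0 < (b : ℝ) + y' := by linarith [hy0.1]
  have ex : x = 1 / (a + x') := by rw [eq_div_iff hX.ne']; exact hx
  have ey : y = 1 / (b + y') := by rw [eq_div_iff hY.ne']; exact hy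
  have hy1 : 1 / (M + 1) ≤ y' := by
    rw [div_le_iff₀ (by linarith)]
    nlinarith [hy0.1, hy''.2]
  have e : x - y = (b + y' - (a + x')) / ((a + x') * (b + y')) := by
    rw [ex, ey]
    field_simp
  have h1 : 1 / (M + 1) ≤ b + y' - (a + x') := by linarith [hx'.2]
  have h2 : (a + x') * (b + y') ≤ (M + 1) ^ 2 := by
    rw [sq]
    exact mul_le_mul (by linarith [hx'.2]) (by linarith [hy0.2]) hY.le (by linarith)
  have h3 : 1 / (M + 1) ^ 3 ≤ x - y := by
    rw [e, show 1 / (M + 1) ^ 3 = 1 / (M + 1) / (M + 1) ^ 2 by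
      rw [div_div, ← pow_succ']]
    exact div_le_div₀ (by linarith [show 0 < 1 / (M + 1) by positivity]) h1 (by positivity) h2
  exact h3.trans (le_abs_self _)
/-- The distribution function of the partial quotient following a fundamental interval with
denominator ratio `t`, conditioned on this partial quotient being at most `M`. -/
noncomputable def quotCdf (M : ℕ) (t : ℝ) (a : ℕ) : ℝ := a / (a + 1 + t) * ((M + 1 + t) / M)

/-- The quantile function of `quotCdf`. -/
noncomputable def quotPick (M : ℕ) (t u : ℝ) : ℕ := sInf {a | u < quotCdf M t a}

section QuotPick

variable {M : ℕ} {t u : ℝ}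

lemma quotCdf_self (hM : 0 < M) (ht : 0 ≤ t) : quotCdf M t M = 1 := by
  have : (0 : ℝ) < M := by exact_mod_cast hM
  rw [quotCdf]
  field_simp

lemma quotPick_le (hM : 0 < M) (ht : 0 ≤ t) (hu : u < 1) : quotPick M t u ≤ M :=
  Nat.sInf_le (by rwa [mem_ofPred_eq, quotCdf_self hM ht])

lemma lt_quotCdf_quotPick (hM : 0 < M) (ht : 0 ≤ t) (hu : u < 1) :
    u < quotCdf M t (quotPick M t u) :=
  Nat.sInf_mem (s := {a | u < quotCdf M t a}) ⟨M, by rwa [mem_ofPred_eq, quotCdf_self hM ht]⟩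

lemma one_le_quotPick (hM : 0 < M) (ht : 0 ≤ t) (hu0 : 0 ≤ u) (hu : u < 1) :
    1 ≤ quotPick M t u := by
  by_contra! h
  have h' := lt_quotCdf_quotPick hM ht hu
  rw [Nat.lt_one_iff.1 h, quotCdf] at h'
  simp at h'
  linarith

lemma quotCdf_pred_le (hM : 0 < M) (ht : 0 ≤ t) (hu0 : 0 ≤ u) (hu : u < 1) :
    quotCdf M t (quotPick M t u - 1) ≤ u := by
  have h : quotPick M t u - 1 < quotPick M t u := by
    have := one_le_quotPick hM ht hu0 hu
    omega
  simpa using Nat.notMem_of_lt_sInf h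

lemma quotCdf_sub_pred {a : ℕ} (ha : 1 ≤ a) (ht : 0 ≤ t) :
    quotCdf M t a - quotCdf M t (a - 1)
      = (1 + t) / ((a + t) * (a + t + 1)) * ((M + 1 + t) / M) := by
  have h1 : (1 : ℝ) ≤ a := by exact_mod_cast ha
  have : (a : ℝ) + t ≠ 0 := by positivity
  have : (a : ℝ) + t + 1 ≠ 0 := by positivity
  rw [quotCdf, quotCdf, ← sub_mul, Nat.cast_sub ha, Nat.cast_one,
    show (a : ℝ) + 1 + t = a + t + 1 by ring, show (a : ℝ) - 1 + 1 + t = a + t by ring]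
  congr 1
  field_simp
  ring

end QuotPick

/-- The next partial quotient: prescribed to be `b n` unless `b n = 0`. -/
noncomputable def nextQuot (M : ℕ) (b : ℕ → ℕ) (n : ℕ) (s : ℝ × ℝ) : ℕ :=
  if b n = 0 then quotPick M s.1 s.2 else b n

/-- The orbit of `u ∈ [0, 1)`, together with the denominator ratios, in the expansion where
the partial quotients with `b n = 0` are at most `M` and the others are prescribed. -/
noncomputable def orbit (M : ℕ) (b : ℕ → ℕ) (u : ℝ) : ℕ → ℝ × ℝ
  | 0 => (0, u)
  | n + 1 =>
    (1 / (nextQuot M b n (orbit M b u n) + (orbit M b u n).1),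
      if b n = 0 then
        ((orbit M b u n).2 - quotCdf M (orbit M b u n).1 (nextQuot M b n (orbit M b u n) - 1)) /
          (quotCdf M (orbit M b u n).1 (nextQuot M b n (orbit M b u n)) -
            quotCdf M (orbit M b u n).1 (nextQuot M b n (orbit M b u n) - 1))
      else (orbit M b u n).2)

/-- The partial quotients attached to `u ∈ [0, 1)`. -/
noncomputable def quots (M : ℕ) (b : ℕ → ℕ) (u : ℝ) (n : ℕ) : ℕ := nextQuot M b n (orbit M b u n)

/-- The factor lost at each step of the comparison of lengths. -/
noncomputable def stepLoss (M : ℕ) (b : ℕ → ℕ) (n : ℕ) : ℝ :=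
  if b n = 0 then 1 + 2 / M else (b n + 1) * (b n + 2)

section Quots

variable {M : ℕ} {b : ℕ → ℕ} {u v : ℝ}

lemma stepLoss_nonneg (n : ℕ) : 0 ≤ stepLoss M b n := by
  rw [stepLoss]
  split_ifs <;> positivity

lemma orbit_fst (n : ℕ) : (orbit M b u n).1 = denRatio (quots M b u) n := by
  induction n with
  | zero => rfl
  | succ n ih => rw [orbit, denRatio, ← ih, quots]

lemma orbit_snd_succ (n : ℕ) : (orbit M b u (n + 1)).2 =
    if b n = 0 then
      ((orbit M b u n).2 - quotCdf M (orbit M b u n).1 (quots M b u n - 1)) /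
        (quotCdf M (orbit M b u n).1 (quots M b u n) -
          quotCdf M (orbit M b u n).1 (quots M b u n - 1))
    else (orbit M b u n).2 := rfl

lemma one_le_nextQuot (hM : 0 < M) {s : ℝ × ℝ} (ht : 0 ≤ s.1) (hs : s.2 ∈ Ico (0 : ℝ) 1) (n : ℕ) :
    1 ≤ nextQuot M b n s := by
  rw [nextQuot]
  split_ifs with h
  · exact one_le_quotPick hM ht hs.1 hs.2
  · omega

lemma orbit_mem (hM : 0 < M) (hu : u ∈ Ico (0 : ℝ) 1) (n : ℕ) :
    0 ≤ (orbit M b u n).1 ∧ (orbit M b u n).2 ∈ Ico (0 : ℝ) 1 := by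
  induction n with
  | zero => simpa [orbit] using hu
  | succ n ih =>
    refine ⟨?_, ?_⟩
    · rw [orbit]
      have := ih.1
      positivity
    · rw [orbit_snd_succ]
      split_ifs with h
      · have e : quots M b u n = quotPick M (orbit M b u n).1 (orbit M b u n).2 := by
          rw [quots, nextQuot, if_pos h]
        have h1 := lt_quotCdf_quotPick hM ih.1 ih.2.2
        have h2 := quotCdf_pred_le hM ih.1 ih.2.1 ih.2.2
        rw [e]
        refine ⟨div_nonneg (by linarith) (by linarith), ?_⟩
        rw [div_lt_one (by linarith)]
        linarith
      · exact ih.2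

lemma one_le_quots (hM : 0 < M) (hu : u ∈ Ico (0 : ℝ) 1) (n : ℕ) : 1 ≤ quots M b u n :=
  one_le_nextQuot hM (orbit_mem hM hu n).1 (orbit_mem hM hu n).2 n

lemma quots_of_ne_zero {n : ℕ} (h : b n ≠ 0) : quots M b u n = b n := by
  rw [quots, nextQuot, if_neg h]

lemma quots_le (hM : 0 < M) (hu : u ∈ Ico (0 : ℝ) 1) {n : ℕ} (h : b n = 0) :
    quots M b u n ≤ M := by
  rw [quots, nextQuot, if_pos h]
  exact quotPick_le hM (orbit_mem hM hu n).1 (orbit_mem hM hu n).2.2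

lemma abs_sub_mul_invLen_le (hM : 0 < M) (hu : u ∈ Ico (0 : ℝ) 1) {n : ℕ}
    (h : ∀ i < n, quots M b u i = quots M b v i) :
    |u - v| * invLen (quots M b u) n
      ≤ (∏ i ∈ Finset.range n, stepLoss M b i) * |(orbit M b u n).2 - (orbit M b v n).2| := by
  induction n with
  | zero => simp [invLen, den, denRatio, orbit]
  | succ n ih =>
    specialize ih fun i hi => h i (by omega)
    have ht : (orbit M b v n).1 = (orbit M b u n).1 := by
      rw [orbit_fst, orbit_fst]
      exact denRatio_congr fun i hi => (h i (by omega)).symm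
    have hn := h n (by omega)
    have hd := one_le_quots (M := M) (b := b) hM hu
    have ha : (1 : ℝ) ≤ quots M b u n := by exact_mod_cast hd n
    have hM' : (1 : ℝ) ≤ M := by exact_mod_cast hM
    obtain ⟨ht0, ht1⟩ := denRatio_mem_Icc hd n
    rw [invLen_succ hd, ← mul_assoc, Finset.prod_range_succ]
    set t := denRatio (quots M b u) n with htdef
    set r := (quots M b u n + t) * (quots M b u n + t + 1) / (1 + t) with hr
    have hr0 : 0 < r := by positivity
    set G := ∏ i ∈ Finset.range n, stepLoss M b i
    have hG : 0 ≤ G := Finset.prod_nonneg fun i _ => stepLoss_nonneg i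
    have key : |(orbit M b u n).2 - (orbit M b v n).2| * r ≤
        stepLoss M b n * |(orbit M b u (n + 1)).2 - (orbit M b v (n + 1)).2| := by
      rw [orbit_snd_succ, orbit_snd_succ, stepLoss]
      split_ifs with hb
      · rw [ht, ← hn, ← sub_div, sub_sub_sub_cancel_right, quotCdf_sub_pred (hd n)
          (by rw [orbit_fst]; exact ht0), orbit_fst, ← htdef, abs_div]
        have e : (1 + t) / ((quots M b u n + t) * (quots M b u n + t + 1)) * ((M + 1 + t) / M)
            = (M + 1 + t) / M / r := by
          rw [hr]
          field_simp
        have hp : 0 < (M + 1 + t) / M / r := by positivity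
        rw [e, abs_of_pos hp, ← mul_div_assoc (1 + 2 / (M : ℝ)), le_div_iff₀ hp]
        have : |(orbit M b u n).2 - (orbit M b v n).2| * r * ((M + 1 + t) / M / r)
            = (M + 1 + t) / M * |(orbit M b u n).2 - (orbit M b v n).2| := by
          field_simp
        rw [this]
        refine mul_le_mul_of_nonneg_right ?_ (abs_nonneg _)
        rw [div_le_iff₀ (by linarith), add_mul, div_mul_cancel₀ _ (by linarith)]
        linarith
      · rw [mul_comm]
        refine mul_le_mul_of_nonneg_right ?_ (abs_nonneg _)
        rw [hr, quots_of_ne_zero hb, div_le_iff₀ (by linarith)]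
        rw [quots_of_ne_zero hb] at ha
        have : (b n + t) * (b n + t + 1) ≤ ((b n : ℝ) + 1) * (b n + 2) :=
          mul_le_mul (by linarith) (by linarith) (by linarith) (by linarith)
        exact this.trans (le_mul_of_one_le_right (by positivity) (by linarith))
    calc |u - v| * invLen (quots M b u) n * r
        ≤ G * |(orbit M b u n).2 - (orbit M b v n).2| * r :=
          mul_le_mul_of_nonneg_right ih hr0.le
      _ ≤ G * (stepLoss M b n * |(orbit M b u (n + 1)).2 - (orbit M b v (n + 1)).2|) := by
          rw [mul_assoc]
          exact mul_le_mul_of_nonneg_left key hG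
      _ = _ := by ring

lemma abs_sub_mul_invLen_le_prod (hM : 0 < M) (hu : u ∈ Ico (0 : ℝ) 1) (hv : v ∈ Ico (0 : ℝ) 1)
    {n : ℕ} (h : ∀ i < n, quots M b u i = quots M b v i) :
    |u - v| * invLen (quots M b u) n ≤ ∏ i ∈ Finset.range n, stepLoss M b i := by
  refine (abs_sub_mul_invLen_le hM hu h).trans
    (mul_le_of_le_one_right (Finset.prod_nonneg fun i _ => stepLoss_nonneg i) ?_)
  have h1 := (orbit_mem (b := b) hM hu n).2
  have h2 := (orbit_mem (b := b) hM hv n).2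
  rw [abs_le]
  constructor <;> linarith [h1.1, h1.2, h2.1, h2.2]

lemma abs_sub_le_rpow (hM : 0 < M) (hu : u ∈ Ico (0 : ℝ) 1) (hv : v ∈ Ico (0 : ℝ) 1)
    {s C : ℝ} (hs : s ≤ 1)
    (hC : ∀ n, ∏ i ∈ Finset.range n, stepLoss M b i ≤ C * ((2 : ℝ) ^ n) ^ (1 - s))
    {n : ℕ} (h : ∀ i < n, quots M b u i = quots M b v i) :
    |u - v| ≤ C * (invLen (quots M b u) n) ^ (-s) := by
  have hd := one_le_quots (M := M) (b := b) hM hu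
  have hY := invLen_pos hd n
  have hC0 : 0 ≤ C := by simpa using zero_le_one.trans (hC 0)
  have h1 := (abs_sub_mul_invLen_le_prod hM hu hv h).trans (hC n)
  have h2 : ((2 : ℝ) ^ n) ^ (1 - s) ≤ invLen (quots M b u) n ^ (1 - s) :=
    Real.rpow_le_rpow (by positivity) (two_pow_le_invLen hd n) (by linarith)
  have h3 := h1.trans (mul_le_mul_of_nonneg_left h2 hC0)
  rw [← le_div_iff₀ hY, mul_div_assoc] at h3
  rwa [← Real.rpow_sub_one hY.ne', show 1 - s - 1 = -s by ring] at h3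

lemma eq_of_quots_eq (hM : 0 < M) (hu : u ∈ Ico (0 : ℝ) 1) (hv : v ∈ Ico (0 : ℝ) 1)
    {s C : ℝ} (hs0 : 0 < s) (hs : s ≤ 1)
    (hC : ∀ n, ∏ i ∈ Finset.range n, stepLoss M b i ≤ C * ((2 : ℝ) ^ n) ^ (1 - s))
    (h : ∀ i, quots M b u i = quots M b v i) : u = v := by
  have hd := one_le_quots (M := M) (b := b) hM hu
  have h1 : Tendsto (fun n => C * (invLen (quots M b u) n) ^ (-s)) atTop (nhds (C * 0)) :=
    ((tendsto_rpow_neg_atTop hs0).comp (tendsto_atTop_mono (two_pow_le_invLen hd)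
      (tendsto_pow_atTop_atTop_of_one_lt (by norm_num)))).const_mul C
  have h2 := ge_of_tendsto' h1 fun n => abs_sub_le_rpow hM hu hv hs hC (n := n) fun i _ => h i
  rw [mul_zero] at h2
  exact sub_eq_zero.1 (abs_eq_zero.1 (le_antisymm h2 (abs_nonneg _)))

/-- The map from continued fractions to `[0, 1)` is Hölder continuous. -/
lemma abs_sub_le_mul_abs_sub_rpow (hM : 0 < M) (hb : ∀ n, b n = 0 → b (n + 1) ≤ M)
    (hu : u ∈ Ico (0 : ℝ) 1) (hv : v ∈ Ico (0 : ℝ) 1)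
    {s C : ℝ} (hs0 : 0 < s) (hs : s ≤ 1)
    (hC : ∀ n, ∏ i ∈ Finset.range n, stepLoss M b i ≤ C * ((2 : ℝ) ^ n) ^ (1 - s)) {x y : ℕ → ℝ}
    (hx : ∀ n, x n ∈ Ioo (0 : ℝ) 1 ∧ x n * (quots M b u n + x (n + 1)) = 1)
    (hy : ∀ n, y n ∈ Ioo (0 : ℝ) 1 ∧ y n * (quots M b v n + y (n + 1)) = 1) :
    |u - v| ≤ C * (2 * ((M : ℝ) + 1) ^ 3) ^ s * |x 0 - y 0| ^ s := by
  have hC0 : 0 ≤ C := by simpa using zero_le_one.trans (hC 0)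
  by_cases hall : ∀ i, quots M b u i = quots M b v i
  · rw [eq_of_quots_eq hM hu hv hs0 hs hC hall, sub_self, abs_zero]
    positivity
  push Not at hall
  classical
  set n := Nat.find hall
  have hn : quots M b u n ≠ quots M b v n := Nat.find_spec hall
  have h : ∀ i < n, quots M b u i = quots M b v i := fun i hi => not_not.1 (Nat.find_min hall hi)
  have hbn : b n = 0 := by
    by_contra h0
    exact hn (by rw [quots_of_ne_zero h0, quots_of_ne_zero h0])
  have hnext : ∀ {w}, w ∈ Ico (0 : ℝ) 1 → quots M b w (n + 1) ≤ M := fun hw => by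
    by_cases h0 : b (n + 1) = 0
    · exact quots_le hM hw h0
    · rw [quots_of_ne_zero h0]
      exact hb n hbn
  have hd := one_le_quots (M := M) (b := b) hM hu
  have he := one_le_quots (M := M) (b := b) hM hv
  have hgap : 1 / ((M : ℝ) + 1) ^ 3 ≤ |x n - y n| := by
    rcases lt_or_gt_of_ne hn with hlt | hlt
    · exact le_abs_sub_of_lt hlt (by exact_mod_cast quots_le hM hv hbn)
        (by exact_mod_cast hnext hv) (hx n).2 (hy n).2 (hy (n + 1)).2 (hx _).1 (hy _).1 (hy _).1
    · rw [abs_sub_comm]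
      exact le_abs_sub_of_lt hlt (by exact_mod_cast quots_le hM hu hbn)
        (by exact_mod_cast hnext hu) (hy n).2 (hx n).2 (hx (n + 1)).2 (hy _).1 (hx _).1 (hx _).1
  have h1 := hgap.trans (abs_sub_le_invLen_mul hd he hx hy h)
  have hY := invLen_pos hd n
  have h2 : (invLen (quots M b u) n)⁻¹ ≤ 2 * ((M : ℝ) + 1) ^ 3 * |x 0 - y 0| := by
    rw [div_le_iff₀ (by positivity)] at h1
    rw [inv_le_iff_one_le_mul₀ hY]
    linarith
  calc |u - v| ≤ C * (invLen (quots M b u) n) ^ (-s) := abs_sub_le_rpow hM hu hv hs hC h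
    _ = C * ((invLen (quots M b u) n)⁻¹) ^ s := by rw [Real.rpow_neg hY.le, Real.inv_rpow hY.le]
    _ ≤ C * (2 * ((M : ℝ) + 1) ^ 3 * |x 0 - y 0|) ^ s := by gcongr
    _ = _ := by rw [Real.mul_rpow (by positivity) (abs_nonneg _), mul_assoc]

end Quots

/-- A lower bound for the dimension of a set of continued fractions whose partial quotients
are prescribed where `b n ≠ 0` and run through `1, …, M` elsewhere. -/
theorem le_dimH_prescribed {M : ℕ} {b : ℕ → ℕ} (hM : 0 < M) (hb : ∀ n, b n = 0 → b (n + 1) ≤ M)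
    {s : NNReal} {C : ℝ} (hs0 : 0 < s) (hs : s ≤ 1)
    (hC : ∀ n, ∏ i ∈ Finset.range n, stepLoss M b i ≤ C * ((2 : ℝ) ^ n) ^ (1 - s : ℝ)) :
    (s : ℝ≥0∞) ≤ dimH {x : ℝ | x ∈ Ioo (0 : ℝ) 1 ∧ Irrational x ∧ ∀ n,
      1 ≤ pq x (n + 1) ∧ (b n ≠ 0 → pq x (n + 1) = b n) ∧ (b n = 0 → pq x (n + 1) ≤ M)} := by
  have hex : ∀ u ∈ Ico (0 : ℝ) 1, ∃ x : ℕ → ℝ,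
      ∀ n, x n ∈ Ioo (0 : ℝ) 1 ∧ x n * (quots M b u n + x (n + 1)) = 1 :=
    fun u hu => exists_completeQuotients (one_le_quots hM hu)
  choose! x hx using hex
  have hs0' : (0 : ℝ) < s := by exact_mod_cast hs0
  have hs' : (s : ℝ) ≤ 1 := by exact_mod_cast hs
  have hhold : ∀ u ∈ Ico (0 : ℝ) 1, ∀ v ∈ Ico (0 : ℝ) 1,
      |u - v| ≤ C * (2 * ((M : ℝ) + 1) ^ 3) ^ (s : ℝ) * |x u 0 - x v 0| ^ (s : ℝ) :=
    fun u hu v hv => abs_sub_le_mul_abs_sub_rpow hM hb hu hv hs0' hs' hC (hx u hu) (hx v hv)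
  have hinj : InjOn (fun u => x u 0) (Ico (0 : ℝ) 1) := fun u hu v hv huv => by
    have h := hhold u hu v hv
    rw [show x u 0 = x v 0 from huv, sub_self, abs_zero, Real.zero_rpow hs0'.ne', mul_zero] at h
    exact sub_eq_zero.1 (abs_eq_zero.1 (le_antisymm h (abs_nonneg _)))
  set F := Function.invFunOn (fun u => x u 0) (Ico (0 : ℝ) 1)
  have hF : ∀ u ∈ Ico (0 : ℝ) 1, F (x u 0) = u := hinj.leftInvOn_invFunOn
  have hC0 : 0 ≤ C := by simpa using zero_le_one.trans (hC 0)
  set K : NNReal := ⟨C * (2 * ((M : ℝ) + 1) ^ 3) ^ (s : ℝ), by positivity⟩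
  have hholder : HolderOnWith K s F ((fun u => x u 0) '' Ico (0 : ℝ) 1) := by
    rintro _ ⟨u, hu, rfl⟩ _ ⟨v, hv, rfl⟩
    simp only [hF u hu, hF v hv]
    rw [edist_dist, edist_dist, Real.dist_eq, Real.dist_eq,
      ENNReal.ofReal_rpow_of_nonneg (abs_nonneg _) hs0'.le,
      ← ENNReal.ofReal_coe_nnreal, ← ENNReal.ofReal_mul K.coe_nonneg]
    exact ENNReal.ofReal_le_ofReal (hhold u hu v hv)
  have himage : F '' ((fun u => x u 0) '' Ico (0 : ℝ) 1) = Ico (0 : ℝ) 1 :=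
    hinj.leftInvOn_invFunOn.image_image
  have h1 := hholder.dimH_image_le hs0
  rw [himage, Real.dimH_of_nonempty_interior (by simp [interior_Ico]), Module.finrank_self,
    Nat.cast_one, ENNReal.le_div_iff_mul_le (Or.inl (by exact_mod_cast hs0.ne'))
      (Or.inl ENNReal.coe_ne_top), one_mul] at h1
  refine h1.trans (dimH_mono ?_)
  rintro _ ⟨u, hu, rfl⟩
  refine ⟨(hx u hu 0).1, irrational_of_completeQuotients (hx u hu), fun n => ?_⟩
  rw [pq_succ_eq (hx u hu)]
  exact ⟨one_le_quots hM hu n, quots_of_ne_zero, quots_le hM hu⟩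
section Regularity

variable {f : ℝ → ℝ} {ρ : ℝ}

lemma RegInc.exists_antitoneOn (hf : RegInc f ρ) {r : ℝ} (hr : ρ < r) :
    ∃ X > (0 : ℝ), (∀ x ∈ Ici X, 0 < f x) ∧ AntitoneOn (fun x => f x * x ^ (-r)) (Ici X) := by
  obtain ⟨c, hc, f', hpos, hderiv, -, -, -, hlim⟩ := hf
  obtain ⟨X, hX⟩ := eventually_atTop.1 (hlim.eventually_lt_const hr)
  have hc' : ∀ {x}, x ∈ Ici (max X c) → c ≤ x := fun hx => (le_max_right _ _).trans hx
  refine ⟨max X c, hc.trans_le (le_max_right _ _), fun x hx => hpos x (hc' hx), ?_⟩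
  have hd : ∀ x ∈ Ici (max X c), HasDerivAt (fun x => f x * x ^ (-r))
      (f' x * x ^ (-r) + f x * (-r * x ^ (-r - 1))) x := fun x hx =>
    (hderiv x (hc' hx)).mul (Real.hasDerivAt_rpow_const (Or.inl (hc.trans_le (hc' hx)).ne'))
  refine antitoneOn_of_deriv_nonpos (convex_Ici _)
    (fun x hx => (hd x hx).continuousAt.continuousWithinAt)
    (fun x hx => (hd x (interior_subset hx)).differentiableAt.differentiableWithinAt)
    fun x hx => ?_
  replace hx := interior_subset hx
  have hx0 : 0 < x := hc.trans_le (hc' hx)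
  have h1 := hX x ((le_max_left _ _).trans hx)
  rw [div_lt_iff₀ (hpos x (hc' hx))] at h1
  have h2 : x ^ (-r) = x ^ (-r - 1) * x := by
    rw [← Real.rpow_add_one hx0.ne', sub_add_cancel]
  rw [(hd x hx).deriv, h2]
  have h3 : 0 < x ^ (-r - 1) := Real.rpow_pos_of_pos hx0 _
  nlinarith

lemma RegInc.tendsto_div_sqrt (hf : RegInc f ρ) (hρ : ρ < 1 / 2) :
    Tendsto (fun x => f x / √x) atTop (nhds 0) := by
  obtain ⟨r, hr, hr'⟩ := exists_between hρ
  obtain ⟨X, hX, hpos, hanti⟩ := hf.exists_antitoneOn hr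
  have h1 : Tendsto (fun x : ℝ => f X * X ^ (-r) * x ^ (-(1 / 2 - r))) atTop
      (nhds (f X * X ^ (-r) * 0)) := (tendsto_rpow_neg_atTop (by linarith)).const_mul _
  rw [mul_zero] at h1
  refine tendsto_of_tendsto_of_tendsto_of_le_of_le' tendsto_const_nhds h1 ?_ ?_
  · filter_upwards [eventually_ge_atTop X] with x hx
    exact div_nonneg (hpos x hx).le (Real.sqrt_nonneg x)
  · filter_upwards [eventually_ge_atTop X] with x hx
    have hx0 : 0 < x := hX.trans_le hx
    have h2 := hanti self_mem_Ici hx hx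
    have h3 : f x / √x = f x * x ^ (-r) * x ^ (-(1 / 2 - r)) := by
      rw [mul_assoc, ← Real.rpow_add hx0, Real.sqrt_eq_rpow, div_eq_mul_inv,
        ← Real.rpow_neg hx0.le]
      ring_nf
    rw [h3]
    exact mul_le_mul_of_nonneg_right h2 (Real.rpow_nonneg hx0.le _)

lemma RegInc.tendsto_sub_sq (hf : RegInc f ρ) (hρ : ρ < 1 / 2)
    (hmono : MonotoneOn f (Ioi 0)) :
    Tendsto (fun k : ℕ => f ((k : ℝ) ^ 2) - f (((k : ℝ) + 1) ^ 2)) atTop (nhds 0) := by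
  have hsq : Tendsto (fun k : ℕ => (k : ℝ) ^ 2) atTop atTop :=
    (tendsto_pow_atTop two_ne_zero).comp tendsto_natCast_atTop_atTop
  have h1 : Tendsto (fun k : ℕ => -(f ((k : ℝ) ^ 2) / √((k : ℝ) ^ 2))) atTop (nhds (-0)) :=
    ((hf.tendsto_div_sqrt hρ).comp hsq).neg
  rw [neg_zero] at h1
  obtain ⟨X, hX, hpos, hanti⟩ := hf.exists_antitoneOn hρ
  refine tendsto_of_tendsto_of_tendsto_of_le_of_le' h1 tendsto_const_nhds ?_ ?_
  · filter_upwards [hsq.eventually_ge_atTop X, eventually_gt_atTop 0] with k hk hk0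
    have hk0 : (0 : ℝ) < k := by exact_mod_cast hk0
    have hle : (k : ℝ) ^ 2 ≤ ((k : ℝ) + 1) ^ 2 := by nlinarith
    have h2 := hanti hk (hk.trans hle) hle
    have e : ∀ y : ℝ, 0 < y → (y ^ 2) ^ (-(1 / 2) : ℝ) = 1 / y := fun y hy => by
      rw [Real.rpow_neg (by positivity), ← Real.sqrt_eq_rpow, Real.sqrt_sq hy.le, one_div]
    simp only [e _ hk0, e _ (by linarith : 0 < (k : ℝ) + 1), mul_one_div] at h2
    rw [div_le_iff₀ (by linarith), mul_add, mul_one, div_mul_cancel₀ _ hk0.ne'] at h2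
    rw [Real.sqrt_sq hk0.le]
    linarith
  · filter_upwards [eventually_gt_atTop 0] with k hk0
    have hk0 : (0 : ℝ) < k := by exact_mod_cast hk0
    exact sub_nonpos.2 (hmono (by simpa using by positivity) (by simpa using by positivity)
      (by nlinarith))

end Regularity

/-- Partial quotients slightly larger than `φ` are prescribed at the squares, with neighbours equal
to `1`; the value `0` marks the free positions. -/
noncomputable def sqQuot (φ : ℝ → ℝ) (n : ℕ) : ℕ :=
  open Classical in
  if IsSquare n then ⌊φ n⌋₊ + 1 else if IsSquare (n + 1) ∨ IsSquare (n - 1) then 1 else 0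

section SqQuot

variable {φ : ℝ → ℝ}

lemma sqQuot_of_isSquare {n : ℕ} (h : IsSquare n) : sqQuot φ n = ⌊φ n⌋₊ + 1 := by
  rw [sqQuot, if_pos h]

lemma sqQuot_of_neighbour {n : ℕ} (h : ¬ IsSquare n) (h' : IsSquare (n + 1) ∨ IsSquare (n - 1)) :
    sqQuot φ n = 1 := by
  rw [sqQuot, if_neg h, if_pos h']

lemma sqQuot_eq_zero_iff {n : ℕ} :
    sqQuot φ n = 0 ↔ ¬ IsSquare n ∧ ¬ IsSquare (n + 1) ∧ ¬ IsSquare (n - 1) := by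
  rw [sqQuot]
  split_ifs with h h'
  · simp [h]
  · simp only [false_iff]
    tauto
  · simp only [true_iff]
    tauto

lemma sqQuot_succ_le_one {n : ℕ} (h : sqQuot φ n = 0) : sqQuot φ (n + 1) ≤ 1 := by
  rw [sqQuot, if_neg (sqQuot_eq_zero_iff.1 h).2.1]
  split_ifs <;> omega

lemma not_isSquare_succ {n : ℕ} (hn : 1 ≤ n) (h : IsSquare n) : ¬ IsSquare (n + 1) := by
  rintro ⟨l, hl⟩
  obtain ⟨k, rfl⟩ := h
  have hkl : k + 1 ≤ l := by nlinarith
  have := Nat.mul_le_mul hkl hkl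
  nlinarith

lemma sqQuot_le (hφpos : ∀ x > (0 : ℝ), 0 < φ x) (hφmono : MonotoneOn φ (Ioi (0 : ℝ)))
    {i n : ℕ} (hin : i ≤ n) (hn : 1 ≤ n) : (sqQuot φ i : ℝ) ≤ φ n + (⌊φ 0⌋₊ + 1) := by
  have hn0 : (0 : ℝ) < n := by exact_mod_cast hn
  have hφn := hφpos n hn0
  by_cases hs : IsSquare i
  · rw [sqQuot_of_isSquare hs]
    rcases Nat.eq_zero_or_pos i with rfl | hi
    · push_cast
      linarith
    · have hi0 : (0 : ℝ) < i := by exact_mod_cast hi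
      have h1 := Nat.floor_le (hφpos i hi0).le
      have h2 := hφmono hi0 hn0 (by exact_mod_cast hin)
      push_cast
      linarith [(⌊φ 0⌋₊).cast_nonneg (α := ℝ)]
  · have h1 : sqQuot φ i ≤ 1 := by
      rw [sqQuot, if_neg hs]
      split_ifs <;> omega
    have h2 : (sqQuot φ i : ℝ) ≤ 1 := by exact_mod_cast h1
    linarith [(⌊φ 0⌋₊).cast_nonneg (α := ℝ)]

lemma card_sqQuot_ne_zero_le (n : ℕ) :
    ((Finset.range n).filter fun i => sqQuot φ i ≠ 0).card ≤ 3 * (Nat.sqrt n + 1) := by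
  have hsub : ((Finset.range n).filter fun i => sqQuot φ i ≠ 0) ⊆
      (Finset.range 3 ×ˢ Finset.range (Nat.sqrt n + 1)).image fun p => p.2 * p.2 + p.1 - 1 := by
    intro i hi
    rw [Finset.mem_filter, Finset.mem_range, Ne, sqQuot_eq_zero_iff] at hi
    obtain ⟨hin, hi⟩ := hi
    simp only [Finset.mem_image, Finset.mem_product, Finset.mem_range, Prod.exists,
      Nat.lt_succ_iff, Nat.le_sqrt]
    have hcases : IsSquare i ∨ IsSquare (i + 1) ∨ IsSquare (i - 1) := by tauto
    rcases hcases with ⟨k, hk⟩ | ⟨k, hk⟩ | ⟨k, hk⟩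
    · exact ⟨1, k, by omega⟩
    · exact ⟨0, k, by omega⟩
    · rcases Nat.eq_zero_or_pos i with rfl | hi0
      · exact ⟨0, 0, by omega⟩
      · exact ⟨2, k, by omega⟩
  refine (Finset.card_le_card hsub).trans (Finset.card_image_le.trans ?_)
  simp

lemma prod_stepLoss_sqQuot_le (hφpos : ∀ x > (0 : ℝ), 0 < φ x)
    (hφmono : MonotoneOn φ (Ioi (0 : ℝ))) (M : ℕ) {n : ℕ} (hn : 1 ≤ n) :
    ∏ i ∈ Finset.range n, stepLoss M (sqQuot φ) i ≤
      (1 + 2 / (M : ℝ)) ^ n * (φ n + (⌊φ 0⌋₊ + 3)) ^ (6 * (Nat.sqrt n + 1)) := by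
  have hM : (1 : ℝ) ≤ 1 + 2 / M := by
    have : (0 : ℝ) ≤ 2 / M := by positivity
    linarith
  have hφn := hφpos n (by exact_mod_cast hn)
  have hB : 1 ≤ φ n + ((⌊φ 0⌋₊ : ℝ) + 3) := by linarith [(⌊φ 0⌋₊).cast_nonneg (α := ℝ)]
  set B := φ n + ((⌊φ 0⌋₊ : ℝ) + 3) with hBdef
  have hstep : ∀ i ∈ Finset.range n, stepLoss M (sqQuot φ) i ≤
      (1 + 2 / (M : ℝ)) * if sqQuot φ i ≠ 0 then B ^ 2 else 1 := fun i hi => by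
    rw [stepLoss]
    split_ifs with h
    · exact absurd h ‹_›
    · rw [mul_one]
    · have h1 := sqQuot_le hφpos hφmono (Finset.mem_range.1 hi).le hn
      have h2 : ((sqQuot φ i : ℝ) + 1) * (sqQuot φ i + 2) ≤ B * B := by
        gcongr <;> linarith
      nlinarith [sq_nonneg B]
  refine (Finset.prod_le_prod (fun i _ => stepLoss_nonneg i) hstep).trans ?_
  rw [Finset.prod_mul_distrib, Finset.prod_const, Finset.card_range, ← Finset.prod_filter,
    Finset.prod_const, ← pow_mul]
  refine mul_le_mul_of_nonneg_left (pow_le_pow_right₀ hB ?_) (by positivity)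
  have := card_sqQuot_ne_zero_le (φ := φ) n
  omega

lemma eventually_pow_le (hφ : Tendsto φ atTop atTop)
    (hlog : Tendsto (fun x => Real.log (φ x) / √x) atTop (nhds 0)) (A : ℝ) {δ : ℝ} (hδ : 0 < δ) :
    ∀ᶠ n : ℕ in atTop, (φ n + A) ^ (6 * (Nat.sqrt n + 1)) ≤ Real.exp (δ * n) := by
  have hsqrt : Tendsto (fun x : ℝ => Real.log 2 / √x) atTop (nhds 0) :=
    tendsto_const_nhds.div_atTop Real.tendsto_sqrt_atTop
  have hsum := hsqrt.add hlog
  rw [add_zero] at hsum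
  have hδ' : 0 < δ / 12 := by positivity
  filter_upwards [tendsto_natCast_atTop_atTop.eventually (hsum.eventually_lt_const hδ'),
    tendsto_natCast_atTop_atTop.eventually (hφ.eventually_ge_atTop A),
    tendsto_natCast_atTop_atTop.eventually (hφ.eventually_ge_atTop (1 - A)),
    tendsto_natCast_atTop_atTop.eventually (hφ.eventually_gt_atTop 0),
    eventually_ge_atTop 1] with n h1 h2 h3 h4 hn
  have hn1 : (1 : ℝ) ≤ √n := Real.one_le_sqrt.2 (by exact_mod_cast hn)
  have hss : √(n : ℝ) * √n = n := Real.mul_self_sqrt n.cast_nonneg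
  rw [← add_div, div_lt_iff₀ (by linarith), ← Real.log_mul (by norm_num) h4.ne'] at h1
  have hl : Real.log (φ n + A) ≤ δ / 12 * √n :=
    (Real.log_le_log (by linarith) (by linarith)).trans h1.le
  have hl0 : 0 ≤ Real.log (φ n + A) := Real.log_nonneg (by linarith)
  rw [← Real.log_le_iff_le_exp (by apply pow_pos; linarith), Real.log_pow]
  push_cast
  have hs : (Nat.sqrt n : ℝ) ≤ √n := Real.nat_sqrt_le_real_sqrt
  calc 6 * ((Nat.sqrt n : ℝ) + 1) * Real.log (φ n + A)
      ≤ 12 * √n * (δ / 12 * √n) :=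
        mul_le_mul (by linarith) hl hl0 (by linarith)
    _ = δ * n := by linear_combination δ * hss

lemma exists_prod_stepLoss_le (hφpos : ∀ x > (0 : ℝ), 0 < φ x)
    (hφmono : MonotoneOn φ (Ioi (0 : ℝ))) (hφ : Tendsto φ atTop atTop)
    (hlog : Tendsto (fun x => Real.log (φ x) / √x) atTop (nhds 0)) {s : ℝ} (hs : s < 1) :
    ∃ M : ℕ, 0 < M ∧ ∃ C : ℝ, ∀ n,
      ∏ i ∈ Finset.range n, stepLoss M (sqQuot φ) i ≤ C * ((2 : ℝ) ^ n) ^ (1 - s) := by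
  set δ := Real.log 2 * (1 - s) / 2 with hδ
  have hδ0 : 0 < δ := by
    have := Real.log_pos one_lt_two
    have : 0 < 1 - s := by linarith
    positivity
  have hM : ∀ᶠ M : ℕ in atTop, 1 + 2 / (M : ℝ) < Real.exp δ := by
    have h : Tendsto (fun M : ℕ => 1 + 2 / (M : ℝ)) atTop (nhds (1 + 0)) :=
      (tendsto_const_div_atTop_nhds_zero_nat 2).const_add 1
    exact h.eventually_lt_const (by rw [add_zero]; exact Real.one_lt_exp_iff.2 hδ0)
  obtain ⟨M, hM, hM0⟩ := (hM.and (eventually_gt_atTop 0)).exists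
  obtain ⟨N, hN⟩ := eventually_atTop.1 (eventually_pow_le hφ hlog (⌊φ 0⌋₊ + 3) hδ0)
  have hexp : ∀ n : ℕ, ((2 : ℝ) ^ n) ^ (1 - s) = Real.exp (δ * n) * Real.exp (δ * n) := fun n => by
    rw [← Real.exp_add, ← Real.rpow_natCast, ← Real.rpow_mul (by norm_num),
      Real.rpow_def_of_pos (by norm_num)]
    congr 1
    rw [hδ]
    ring
  have hone : ∀ n : ℕ, 1 ≤ ((2 : ℝ) ^ n) ^ (1 - s) := fun n =>
    Real.one_le_rpow (one_le_pow₀ (by norm_num)) (by linarith)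
  have hP : ∀ n, 0 ≤ ∏ i ∈ Finset.range n, stepLoss M (sqQuot φ) i := fun n =>
    Finset.prod_nonneg fun i _ => stepLoss_nonneg i
  have hS := Finset.sum_nonneg fun m (_ : m ∈ Finset.range (N + 1)) => hP m
  refine ⟨M, hM0, 1 + ∑ m ∈ Finset.range (N + 1), ∏ i ∈ Finset.range m, stepLoss M (sqQuot φ) i,
    fun n => ?_⟩
  rcases le_or_gt n N with hn | hn
  · have h1 := Finset.single_le_sum (fun m _ => hP m) (Finset.mem_range.2 (Nat.lt_succ_of_le hn))
    exact (h1.trans (by linarith)).trans (le_mul_of_one_le_right (by linarith) (hone n))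
  · refine le_trans ?_ (le_mul_of_one_le_left (zero_le_one.trans (hone n)) (by linarith))
    rw [hexp]
    refine (prod_stepLoss_sqQuot_le hφpos hφmono M (by omega)).trans
      (mul_le_mul ?_ (hN n hn.le) ?_ (Real.exp_nonneg _))
    · rw [mul_comm, Real.exp_nat_mul]
      exact pow_le_pow_left₀ (by positivity) hM.le n
    · have := hφpos n (by exact_mod_cast (by omega : 0 < n))
      positivity

lemma Lmax_eq_sup_range (x : ℝ) (n : ℕ) :
    Lmax x n = (Finset.range n).sup fun i => pq x (i + 1) * pq x (i + 2) := by
  rw [Lmax]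
  refine le_antisymm (Finset.sup_le fun i hi => ?_) (Finset.sup_le fun i hi => ?_)
  · rw [Finset.mem_Icc] at hi
    obtain ⟨j, rfl⟩ : ∃ j, i = j + 1 := ⟨i - 1, by omega⟩
    exact Finset.le_sup (f := fun i => pq x (i + 1) * pq x (i + 2)) (Finset.mem_range.2 (by omega))
  · rw [Finset.mem_range] at hi
    exact Finset.le_sup (f := fun i => pq x i * pq x (i + 1))
      (Finset.mem_Icc.2 (by omega : 1 ≤ i + 1 ∧ i + 1 ≤ n))

lemma pq_of_isSquare {M : ℕ} {x : ℝ}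
    (hx : ∀ n, 1 ≤ pq x (n + 1) ∧ (sqQuot φ n ≠ 0 → pq x (n + 1) = sqQuot φ n) ∧
      (sqQuot φ n = 0 → pq x (n + 1) ≤ M)) {n : ℕ} (h : IsSquare n) :
    pq x (n + 1) = ⌊φ n⌋₊ + 1 := by
  rw [(hx n).2.1 (by rw [sqQuot_of_isSquare h]; omega), sqQuot_of_isSquare h]

lemma pq_of_neighbour {M : ℕ} {x : ℝ}
    (hx : ∀ n, 1 ≤ pq x (n + 1) ∧ (sqQuot φ n ≠ 0 → pq x (n + 1) = sqQuot φ n) ∧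
      (sqQuot φ n = 0 → pq x (n + 1) ≤ M)) {n : ℕ} (h : ¬ IsSquare n)
    (h' : IsSquare (n + 1) ∨ IsSquare (n - 1)) : pq x (n + 1) = 1 := by
  rw [(hx n).2.1 (by rw [sqQuot_of_neighbour h h']; omega), sqQuot_of_neighbour h h']

lemma Lmax_le_of_prescribed (hφmono : MonotoneOn φ (Ioi (0 : ℝ))) {M : ℕ} (hM : 0 < M) {x : ℝ}
    (hx : ∀ n, 1 ≤ pq x (n + 1) ∧ (sqQuot φ n ≠ 0 → pq x (n + 1) = sqQuot φ n) ∧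
      (sqQuot φ n = 0 → pq x (n + 1) ≤ M)) (n : ℕ) :
    Lmax x n ≤ max (⌊φ n⌋₊ + 1) (max (pq x 1 * pq x 2) (M * M)) := by
  rw [Lmax_eq_sup_range]
  refine Finset.sup_le fun i hi => ?_
  rw [Finset.mem_range] at hi
  have hfloor : ∀ j : ℕ, 1 ≤ j → j ≤ n → ⌊φ j⌋₊ ≤ ⌊φ n⌋₊ := fun j h1 h2 =>
    Nat.floor_mono (hφmono (by simpa using (by omega : 0 < j))
      (by simpa using (by omega : 0 < n)) (by exact_mod_cast h2))
  rcases Nat.eq_zero_or_pos i with rfl | hi0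
  · exact (le_max_left _ _).trans (le_max_right _ _)
  by_cases hs : IsSquare i
  · rw [pq_of_isSquare hx hs, show i + 2 = i + 1 + 1 by rfl,
      pq_of_neighbour hx (not_isSquare_succ hi0 hs) (Or.inr (by simpa using hs)), mul_one]
    exact le_max_of_le_left (Nat.succ_le_succ (hfloor i hi0 hi.le))
  by_cases hs' : IsSquare (i + 1)
  · rw [pq_of_neighbour hx hs (Or.inl hs'), show i + 2 = i + 1 + 1 by rfl,
      pq_of_isSquare hx hs', one_mul]
    exact le_max_of_le_left (Nat.succ_le_succ (hfloor (i + 1) (by omega) hi))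
  have hle : ∀ j, ¬ IsSquare j → pq x (j + 1) ≤ M := fun j hj => by
    by_cases h : sqQuot φ j = 0
    · exact (hx j).2.2 h
    · rw [pq_of_neighbour hx hj]
      · exact hM
      · rw [sqQuot_eq_zero_iff] at h
        tauto
  exact (Nat.mul_le_mul (hle i hs) (hle (i + 1) hs')).trans
    ((le_max_right _ _).trans (le_max_right _ _))

lemma le_Lmax_of_prescribed {M : ℕ} {x : ℝ}
    (hx : ∀ n, 1 ≤ pq x (n + 1) ∧ (sqQuot φ n ≠ 0 → pq x (n + 1) = sqQuot φ n) ∧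
      (sqQuot φ n = 0 → pq x (n + 1) ≤ M)) {n k : ℕ} (hk : 1 ≤ k) (hkn : k * k ≤ n) :
    φ ((k : ℝ) ^ 2) ≤ Lmax x n := by
  obtain ⟨i, hi⟩ : ∃ i, k * k = i + 1 := ⟨k * k - 1, by have := Nat.mul_le_mul hk hk; omega⟩
  have h1 : pq x (i + 1) * pq x (i + 2) ≤ Lmax x n := by
    rw [Lmax_eq_sup_range]
    exact Finset.le_sup (f := fun i => pq x (i + 1) * pq x (i + 2))
      (Finset.mem_range.2 (by omega))
  have h2 : pq x (i + 2) = ⌊φ (i + 1 : ℕ)⌋₊ + 1 := pq_of_isSquare hx (n := i + 1) ⟨k, hi.symm⟩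
  have h3 : pq x (i + 2) ≤ Lmax x n := (Nat.le_mul_of_pos_left _ (hx i).1).trans h1
  rw [h2, ← hi] at h3
  have h4 : ((⌊φ (k * k : ℕ)⌋₊ + 1 : ℕ) : ℝ) ≤ Lmax x n := by exact_mod_cast h3
  refine le_trans ?_ h4
  push_cast
  rw [sq]
  exact (Nat.lt_floor_add_one _).le

lemma tendsto_Lmax_div (hφpos : ∀ x > (0 : ℝ), 0 < φ x)
    (hφmono : MonotoneOn φ (Ioi (0 : ℝ))) (hφ : Tendsto φ atTop atTop)
    (hratio : Tendsto (fun k : ℕ => φ ((k : ℝ) ^ 2) / φ (((k : ℝ) + 1) ^ 2)) atTop (nhds 1))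
    {M : ℕ} (hM : 0 < M) {x : ℝ}
    (hx : ∀ n, 1 ≤ pq x (n + 1) ∧ (sqQuot φ n ≠ 0 → pq x (n + 1) = sqQuot φ n) ∧
      (sqQuot φ n = 0 → pq x (n + 1) ≤ M)) :
    Tendsto (fun n : ℕ => (Lmax x n : ℝ) / φ n) atTop (nhds 1) := by
  have hφn : Tendsto (fun n : ℕ => φ n) atTop atTop := hφ.comp tendsto_natCast_atTop_atTop
  have hsqrt : Tendsto Nat.sqrt atTop atTop :=
    tendsto_atTop.2 fun b => by
      filter_upwards [eventually_ge_atTop (b * b)] with n hn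
      exact Nat.le_sqrt.2 hn
  have hupper : Tendsto (fun n : ℕ => 1 + 1 / φ n) atTop (nhds 1) := by
    simpa using (tendsto_const_nhds (x := (1 : ℝ))).div_atTop hφn |>.const_add 1
  refine tendsto_of_tendsto_of_tendsto_of_le_of_le' (hratio.comp hsqrt) hupper ?_ ?_
  · filter_upwards [eventually_ge_atTop 1] with n hn
    have hk : 1 ≤ Nat.sqrt n := Nat.le_sqrt.2 hn
    have hk0 : (0 : ℝ) < Nat.sqrt n := by exact_mod_cast hk
    have hn0 : (0 : ℝ) < n := by exact_mod_cast hn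
    have hlt : (n : ℝ) ≤ ((Nat.sqrt n : ℝ) + 1) ^ 2 := by
      exact_mod_cast (Nat.lt_succ_sqrt' n).le
    exact div_le_div₀ (Nat.cast_nonneg _) (le_Lmax_of_prescribed hx hk (Nat.sqrt_le n))
      (hφpos _ hn0) (hφmono hn0 (hn0.trans_le hlt) hlt)
  · filter_upwards [hφn.eventually_ge_atTop (max (pq x 1 * pq x 2) (M * M) : ℕ),
      hφn.eventually_gt_atTop 0] with n h1 h2
    have h3 : (Lmax x n : ℝ) ≤ max (⌊φ n⌋₊ + 1) (max (pq x 1 * pq x 2) (M * M)) := by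
      exact_mod_cast Lmax_le_of_prescribed hφmono hM hx n
    rw [div_le_iff₀ h2, add_mul, one_mul, div_mul_cancel₀ _ h2.ne']
    rw [Nat.cast_max] at h3
    refine h3.trans (max_le ?_ ?_)
    · push_cast
      linarith [Nat.floor_le h2.le]
    · linarith

end SqQuot

/-- Theorem 1.2 (1): if `log φ` is regularly increasing with index `ρ ∈ [0, 1/2)`,
then `dim_H L(φ) = 1`. -/
theorem statement0 (φ : ℝ → ℝ) (ρ : ℝ)
    (hφpos : ∀ x > (0 : ℝ), 0 < φ x)
    (hφmono : MonotoneOn φ (Ioi (0 : ℝ)))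
    (hρ0 : 0 ≤ ρ) (hρ : ρ < 1 / 2)
    (hreg : RegInc (fun x => Real.log (φ x)) ρ) :
    dimH (Lset fun n : ℕ => φ n) = 1 := by
  have hlogmono : MonotoneOn (fun x => Real.log (φ x)) (Ioi 0) := fun x hx y hy hxy =>
    Real.log_le_log (hφpos x hx) (hφmono hx hy hxy)
  have hlogtop : Tendsto (fun x => Real.log (φ x)) atTop atTop := by
    obtain ⟨_, _, _, _, _, _, _, h, _⟩ := hreg
    exact h
  have hφ : Tendsto φ atTop atTop :=
    (Real.tendsto_exp_atTop.comp hlogtop).congr' <| by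
      filter_upwards [eventually_gt_atTop 0] with x hx
      exact Real.exp_log (hφpos x hx)
  have hratio : Tendsto (fun k : ℕ => φ ((k : ℝ) ^ 2) / φ (((k : ℝ) + 1) ^ 2)) atTop (nhds 1) := by
    have h := (Real.continuous_exp.tendsto 0).comp (hreg.tendsto_sub_sq hρ hlogmono)
    rw [Real.exp_zero] at h
    refine h.congr' ?_
    filter_upwards [eventually_gt_atTop 0] with k hk
    have hk0 : (0 : ℝ) < k := by exact_mod_cast hk
    rw [Function.comp_apply, Real.exp_sub, Real.exp_log (hφpos _ (by positivity)),
      Real.exp_log (hφpos _ (by positivity))]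
  refine le_antisymm ?_ (le_of_forall_lt fun c hc => ?_)
  · refine (dimH_mono (subset_univ _)).trans ?_
    rw [Real.dimH_univ]
  obtain ⟨s, hcs, hs1⟩ := ENNReal.lt_iff_exists_nnreal_btwn.1 hc
  have hs0 : 0 < s := by exact_mod_cast pos_of_gt hcs
  have hs1' : s < 1 := by exact_mod_cast hs1
  obtain ⟨M, hM, C, hC⟩ := exists_prod_stepLoss_le hφpos hφmono hφ (hreg.tendsto_div_sqrt hρ)
    (s := s) (by exact_mod_cast hs1')
  have hnext : ∀ n, sqQuot φ n = 0 → sqQuot φ (n + 1) ≤ M := fun n hn =>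
    le_trans (sqQuot_succ_le_one hn) (Nat.succ_le_of_lt hM)
  have hsub : {x : ℝ | x ∈ Ioo (0 : ℝ) 1 ∧ Irrational x ∧ ∀ n, 1 ≤ pq x (n + 1) ∧
      (sqQuot φ n ≠ 0 → pq x (n + 1) = sqQuot φ n) ∧ (sqQuot φ n = 0 → pq x (n + 1) ≤ M)} ⊆
      Lset fun n : ℕ => φ n := fun x hx =>
    ⟨hx.1, hx.2.1, tendsto_Lmax_div hφpos hφmono hφ hratio hM hx.2.2⟩
  exact hcs.trans_le ((le_dimH_prescribed hM hnext hs0 hs1'.le hC).trans (dimH_mono hsub))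
end

section
/- Let φ : ℝ⁺ → ℝ⁺ be an increasing function such that log φ is a regularly increasing function with index ρ, where 1/2 < ρ ≤ 1. Then the Hausdorff dimension of L(φ) equals 1/2. -/
open Filter Set
open scoped ENNReal

/-- `X` is a sequence of continued fraction remainders in `(0,1)` with partial quotients `a`. -/
def IsOrbit (a : ℕ → ℕ) (X : ℕ → ℝ) : Prop :=
  ∀ i, 0 < X i ∧ X i < 1 ∧ X i * (a i + X (i + 1)) = 1

theorem gaussMap_mem {x : ℝ} (h : Irrational x) :
    gaussMap x ∈ Ioo (0 : ℝ) 1 ∧ Irrational (gaussMap x) := by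
  have h1 : Irrational (1 / x) := by simpa using h.inv
  have h2 : Irrational (gaussMap x) := h1.sub_intCast _
  exact ⟨⟨lt_of_le_of_ne (Int.fract_nonneg _) (h2.ne_zero).symm, Int.fract_lt_one _⟩, h2⟩

theorem isOrbit_gaussMap {x : ℝ} (hx : x ∈ Ioo (0 : ℝ) 1) (h : Irrational x) :
    IsOrbit (fun i => pq x (i + 1)) (fun i => gaussMap^[i] x) := by
  have key : ∀ i, gaussMap^[i] x ∈ Ioo (0 : ℝ) 1 ∧ Irrational (gaussMap^[i] x) := by
    intro i
    induction i with
    | zero => exact ⟨hx, h⟩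
    | succ i ih =>
      rw [Function.iterate_succ_apply']
      exact gaussMap_mem ih.2
  intro i
  obtain ⟨⟨h0, h1⟩, -⟩ := key i
  refine ⟨h0, h1, ?_⟩
  have h2 : (pq x (i + 1) : ℝ) + gaussMap^[i + 1] x = 1 / gaussMap^[i] x := by
    rw [Function.iterate_succ_apply', pq, gaussMap, Nat.add_sub_cancel,
      natCast_floor_eq_intCast_floor (by positivity), Int.floor_add_fract]
  simp only [h2]
  field_simp

theorem IsOrbit.eq_inv {a : ℕ → ℕ} {X : ℕ → ℝ} (h : IsOrbit a X) (i : ℕ) :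
    1 / X i = a i + X (i + 1) := by
  have := h i
  rw [div_eq_iff this.1.ne', mul_comm]
  exact this.2.2.symm

theorem IsOrbit.pos {a : ℕ → ℕ} {X : ℕ → ℝ} (h : IsOrbit a X) (i : ℕ) : 1 ≤ a i := by
  by_contra! h0
  have h1 : a i = 0 := by omega
  have := h.eq_inv i
  have h2 := h i
  have h3 := h (i + 1)
  rw [h1] at h2
  push_cast at h2
  nlinarith [h2.2.2]

theorem IsOrbit.iterate_gaussMap {a : ℕ → ℕ} {X : ℕ → ℝ} (h : IsOrbit a X) (i : ℕ) :
    gaussMap^[i] (X 0) = X i := by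
  induction i with
  | zero => rfl
  | succ i ih =>
    rw [Function.iterate_succ_apply', ih, gaussMap, h.eq_inv, Int.fract_natCast_add,
      Int.fract_eq_self.2 ⟨(h (i + 1)).1.le, (h (i + 1)).2.1⟩]

theorem IsOrbit.pq_eq {a : ℕ → ℕ} {X : ℕ → ℝ} (h : IsOrbit a X) (i : ℕ) :
    pq (X 0) (i + 1) = a i := by
  rw [pq, Nat.add_sub_cancel, h.iterate_gaussMap, h.eq_inv]
  have h1 := h (i + 1)
  rw [Nat.floor_eq_iff (by linarith [(a i).cast_nonneg (α := ℝ)])]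
  constructor <;> linarith

theorem IsOrbit.irrational {a : ℕ → ℕ} {X : ℕ → ℝ} (h : IsOrbit a X) : Irrational (X 0) := by
  have key : ∀ q : ℕ, ∀ i, ∀ p : ℕ, X i * q = p → q = 0 := by
    intro q
    induction q using Nat.strong_induction_on with
    | _ q ih =>
      intro i p hp
      by_contra hq
      obtain ⟨h0, h1, h2⟩ := h i
      have hq' : (0 : ℝ) < q := by exact_mod_cast Nat.pos_of_ne_zero hq
      have hpq : p < q := by
        have : (p : ℝ) < q := by rw [← hp]; nlinarith
        exact_mod_cast this
      have hp0 : (0 : ℝ) < p := by rw [← hp]; positivity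
      have hX : X (i + 1) * p = q - a i * p := by
        rw [← hp]; linear_combination q * h2
      have hle : a i * p ≤ q := by
        have : (a i * p : ℝ) ≤ q := by
          have := mul_pos (h (i + 1)).1 hp0
          linarith
        exact_mod_cast this
      have := ih p hpq (i + 1) (q - a i * p) (by rw [hX, Nat.cast_sub hle]; push_cast; ring)
      rw [this] at hp0
      simp at hp0
  rintro ⟨r, hr⟩
  have hr0 : 0 < r := by
    have := (h 0).1
    rw [← hr] at this
    exact_mod_cast this
  refine r.den_nz (key r.den 0 r.num.toNat ?_)
  have h3 : ((r.num.toNat : ℤ) : ℝ) = r.num := by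
    rw [Int.toNat_of_nonneg (Rat.num_pos.2 hr0).le]
  rw [Int.cast_natCast] at h3
  rw [← hr, h3]
  exact_mod_cast Rat.mul_den_eq_num r

theorem IsOrbit.abs_sub_eq {a b : ℕ → ℕ} {X Y : ℕ → ℝ} (hX : IsOrbit a X) (hY : IsOrbit b Y)
    (n : ℕ) (hab : ∀ i < n, a i = b i) :
    |X 0 - Y 0| = |X n - Y n| * ∏ i ∈ Finset.range n, (X i * Y i) := by
  induction n with
  | zero => simp
  | succ n ih =>
    rw [ih fun i hi => hab i (by omega), Finset.prod_range_succ]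
    have h1 := hX n
    have h2 := hY n
    have h3 : X n - Y n = -((X (n + 1) - Y (n + 1)) * (X n * Y n)) := by
      have h4 := h2.2.2
      rw [← hab n (by omega)] at h4
      linear_combination Y n * h1.2.2 - X n * h4
    rw [h3, abs_neg, abs_mul, abs_of_pos (mul_pos h1.1 h2.1)]
    ring

theorem IsOrbit.le_inv {a : ℕ → ℕ} {X : ℕ → ℝ} (h : IsOrbit a X) (i : ℕ) :
    X i ≤ (a i : ℝ)⁻¹ := by
  have h1 := h i
  have h2 := (h (i + 1)).1
  have h3 : (0 : ℝ) < a i := by exact_mod_cast h.pos i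
  rw [le_inv_comm₀ h1.1 h3, ← one_div, h.eq_inv]
  linarith

theorem IsOrbit.inv_le {a : ℕ → ℕ} {X : ℕ → ℝ} (h : IsOrbit a X) (i : ℕ) :
    ((a i : ℝ) + 1)⁻¹ ≤ X i := by
  have h1 := h i
  have h2 := (h (i + 1)).2.1
  rw [inv_le_comm₀ (by positivity) h1.1, ← one_div, h.eq_inv]
  linarith

/-- The `n`-th convergent of the continued fraction with partial quotients `a`. -/
noncomputable def cfConv : ℕ → (ℕ → ℕ) → ℝ
  | 0, _ => 0
  | n + 1, a => 1 / (a 0 + cfConv n fun i => a (i + 1))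

theorem cfConv_nonneg (n : ℕ) (a : ℕ → ℕ) : 0 ≤ cfConv n a := by
  induction n generalizing a with
  | zero => exact le_rfl
  | succ n ih =>
    rw [cfConv]
    have := ih fun i => a (i + 1)
    positivity

theorem dist_cfConv_le (n : ℕ) (a : ℕ → ℕ) (ha : ∀ i, 2 ≤ a i) :
    dist (cfConv n a) (cfConv (n + 1) a) ≤ 1 * (1 / 2) ^ n := by
  induction n generalizing a with
  | zero =>
    have h0 : (2 : ℝ) ≤ a 0 := by exact_mod_cast ha 0
    rw [dist_comm]
    simp only [cfConv, dist_zero_right, add_zero, pow_zero, mul_one]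
    rw [Real.norm_of_nonneg (by positivity), div_le_one (by linarith)]
    linarith
  | succ n ih =>
    have h0 : (2 : ℝ) ≤ a 0 := by exact_mod_cast ha 0
    have h1 := ih (fun i => a (i + 1)) fun i => ha _
    rw [cfConv, cfConv]
    set u := cfConv n fun i => a (i + 1)
    set v := cfConv (n + 1) fun i => a (i + 1)
    have hu : 0 ≤ u := cfConv_nonneg _ _
    have hv : 0 ≤ v := cfConv_nonneg _ _
    rw [Real.dist_eq] at h1 ⊢
    have h2 : 1 / (a 0 + u) - 1 / (a 0 + v) = -(u - v) / ((a 0 + u) * (a 0 + v)) := by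
      field_simp
      ring
    rw [h2, abs_div, abs_neg, abs_of_pos (by positivity : 0 < (a 0 + u) * (a 0 + v)),
      div_le_iff₀ (by positivity)]
    have h3 : 2 ≤ (a 0 + u) * (a 0 + v) := by nlinarith
    calc |u - v| ≤ 1 * (1 / 2) ^ n := h1
      _ = 1 * (1 / 2) ^ (n + 1) * 2 := by ring
      _ ≤ _ := by gcongr

theorem exists_isOrbit (a : ℕ → ℕ) (ha : ∀ i, 2 ≤ a i) : ∃ X, IsOrbit a X := by
  have hlim : ∀ k, ∃ l, Tendsto (fun n => cfConv n fun i => a (i + k)) atTop (nhds l) := fun k =>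
    cauchySeq_tendsto_of_complete (cauchySeq_of_le_geometric (1 / 2) 1 (by norm_num)
      fun n => dist_cfConv_le n _ fun i => ha _)
  choose X hX using hlim
  have h0 : ∀ i, 0 ≤ X i := fun i => ge_of_tendsto' (hX i) fun n => cfConv_nonneg _ _
  have h2 : ∀ i, (2 : ℝ) ≤ a i := fun i => by exact_mod_cast ha i
  have heq : ∀ i, X i = 1 / (a i + X (i + 1)) := by
    intro i
    have h3 := (hX i).comp (tendsto_add_atTop_nat 1)
    refine tendsto_nhds_unique h3 ?_
    have h4 : Tendsto (fun n => 1 / (a i + cfConv n fun j => a (j + (i + 1)))) atTop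
        (nhds (1 / (a i + X (i + 1)))) :=
      tendsto_const_nhds.div (tendsto_const_nhds.add (hX (i + 1)))
        (by linarith [h0 (i + 1), h2 i])
    refine h4.congr fun n => ?_
    simp only [Function.comp, cfConv, zero_add]
    congr! 5
    omega
  refine ⟨X, fun i => ?_⟩
  have h3 := h0 (i + 1)
  have h4 := h2 i
  rw [heq i]
  refine ⟨by positivity, ?_, by field_simp⟩
  rw [div_lt_one (by positivity)]
  linarith

theorem ENNReal.tsum_prod_fin (f : ℕ → ℝ≥0∞) (n : ℕ) :
    ∑' w : Fin n → ℕ, ∏ i, f (w i) = (∑' k, f k) ^ n := by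
  induction n with
  | zero => simp
  | succ n ih =>
    rw [← (Fin.consEquiv fun _ => ℕ).tsum_eq, ENNReal.tsum_prod', pow_succ', ← ih,
      ← ENNReal.tsum_mul_right]
    refine tsum_congr fun k => ?_
    rw [← ENNReal.tsum_mul_left]
    refine tsum_congr fun w => ?_
    simp [Fin.consEquiv, Fin.prod_univ_succ]

theorem abs_sub_le_of_pq_eq {x y : ℝ} (hx : x ∈ Ioo (0 : ℝ) 1) (hxi : Irrational x)
    (hy : y ∈ Ioo (0 : ℝ) 1) (hyi : Irrational y) {n : ℕ} {w : Fin n → ℕ}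
    (hxw : ∀ i : Fin n, pq x (i + 1) = w i) (hyw : ∀ i : Fin n, pq y (i + 1) = w i) :
    |x - y| ≤ (∏ i, (w i : ℝ)) ^ (-2 : ℝ) := by
  have hX := isOrbit_gaussMap hx hxi
  have hY := isOrbit_gaussMap hy hyi
  have h := hX.abs_sub_eq hY n fun i hi => (hxw ⟨i, hi⟩).trans (hyw ⟨i, hi⟩).symm
  have h1 : |x - y| = |gaussMap^[0] x - gaussMap^[0] y| := rfl
  rw [h1, h, Finset.prod_range]
  have h2 : |gaussMap^[n] x - gaussMap^[n] y| ≤ 1 := by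
    obtain ⟨a, b, -⟩ := hX n
    obtain ⟨c, d, -⟩ := hY n
    rw [abs_le]
    constructor <;> linarith
  have h3 : ∀ i : Fin n, gaussMap^[i] x * gaussMap^[i] y ≤ (w i : ℝ)⁻¹ * (w i : ℝ)⁻¹ := by
    intro i
    have a := hX.le_inv i
    have b := hY.le_inv i
    simp only [hxw, hyw] at a b
    exact mul_le_mul a b (hY i).1.le (by positivity)
  calc _ ≤ 1 * ∏ i : Fin n, ((w i : ℝ)⁻¹ * (w i : ℝ)⁻¹) := by
        refine mul_le_mul h2 (Finset.prod_le_prod (fun i _ => ?_) fun i _ => h3 i)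
          (Finset.prod_nonneg fun i _ => ?_) zero_le_one
        all_goals exact (mul_pos (hX i).1 (hY i).1).le
    _ = _ := by
        rw [Finset.prod_mul_distrib, Finset.prod_inv_distrib, one_mul,
          Real.rpow_neg (by positivity), ← mul_inv, ← sq]
        norm_cast

theorem dimH_le_half_of_prod_pq :
    dimH {x : ℝ | x ∈ Ioo (0 : ℝ) 1 ∧ Irrational x ∧
      ∀ C : ℝ, ∀ᶠ n : ℕ in atTop, Real.exp (C * n) ≤ ∏ i ∈ Finset.range n, (pq x (i + 1) : ℝ)}
      ≤ 1 / 2 := by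
  refine le_of_forall_gt_imp_ge_of_dense fun d hd => ?_
  rcases eq_or_ne d ∞ with rfl | hdtop
  · exact le_top
  lift d to NNReal using hdtop
  have hs : (1 / 2 : ℝ) < d := by
    have : ((1 / 2 : NNReal) : ℝ≥0∞) < d := by simpa using hd
    exact_mod_cast this
  set s : ℝ := d.toReal
  obtain ⟨σ, hσ, hσs⟩ := exists_between hs
  set f : ℕ → ℝ≥0∞ := fun k => ENNReal.ofReal ((k : ℝ) ^ (-2 * σ)) with hf
  have hsum : Summable fun k : ℕ => (k : ℝ) ^ (-2 * σ) :=
    Real.summable_nat_rpow.2 (by linarith)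
  set z : ℝ := ∑' k : ℕ, (k : ℝ) ^ (-2 * σ) with hz
  have hz0 : 0 ≤ z := tsum_nonneg fun k => by positivity
  have hfz : ∑' k, f k = ENNReal.ofReal z :=
    (ENNReal.ofReal_tsum_of_nonneg (fun k => by positivity) hsum).symm
  set κ : ℝ := 2 * (s - σ) with hκ
  have hκ0 : 0 < κ := by rw [hκ]; linarith
  set C : ℝ := (2 * z + 1) / κ with hC
  have hC0 : 0 < C := by positivity
  set E : ℕ → Set ℝ := fun N => {x : ℝ | x ∈ Ioo (0 : ℝ) 1 ∧ Irrational x ∧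
    ∀ n ≥ N, Real.exp (C * n) ≤ ∏ i ∈ Finset.range n, (pq x (i + 1) : ℝ)} with hE
  have hcover : {x : ℝ | x ∈ Ioo (0 : ℝ) 1 ∧ Irrational x ∧ ∀ C : ℝ, ∀ᶠ n : ℕ in atTop,
      Real.exp (C * n) ≤ ∏ i ∈ Finset.range n, (pq x (i + 1) : ℝ)} ⊆ ⋃ N, E N := by
    rintro x ⟨h1, h2, h3⟩
    obtain ⟨N, hN⟩ := eventually_atTop.1 (h3 C)
    exact mem_iUnion.2 ⟨N, h1, h2, hN⟩
  refine (dimH_mono hcover).trans ?_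
  rw [dimH_iUnion]
  refine iSup_le fun N => dimH_le_of_hausdorffMeasure_ne_top ?_
  set t : ∀ n : ℕ, (Fin n → ℕ) → Set ℝ := fun n w =>
    {x | x ∈ E N ∧ ∀ i : Fin n, pq x (i + 1) = w i} with ht
  have hdiam : ∀ n, ∀ w : Fin n → ℕ,
      Metric.ediam (t n w) ≤ ENNReal.ofReal ((∏ i, (w i : ℝ)) ^ (-2 : ℝ)) := by
    intro n w
    refine Metric.ediam_le ?_
    rintro x ⟨⟨hx, hxi, -⟩, hxw⟩ y ⟨⟨hy, hyi, -⟩, hyw⟩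
    rw [edist_dist, Real.dist_eq]
    exact ENNReal.ofReal_le_ofReal (abs_sub_le_of_pq_eq hx hxi hy hyi hxw hyw)
  have hprod : ∀ n ≥ N, ∀ w : Fin n → ℕ, (t n w).Nonempty →
      Real.exp (C * n) ≤ ∏ i, (w i : ℝ) := by
    rintro n hn w ⟨x, hx, hxw⟩
    have := hx.2.2 n hn
    rw [Finset.prod_range] at this
    simpa only [hxw] using this
  have hmain := MeasureTheory.Measure.hausdorffMeasure_le_liminf_tsum (ι := fun n => Fin n → ℕ)
    s (E N) (l := atTop) (fun n => ENNReal.ofReal (Real.exp (-2 * C) ^ n)) ?_ t ?_ ?_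
  · refine ne_top_of_le_ne_top ENNReal.one_ne_top (hmain.trans ?_)
    refine (liminf_le_liminf (v := fun _ => (1 : ℝ≥0∞)) ?_).trans (by simp)
    filter_upwards [eventually_ge_atTop N] with n hn
    have hterm : ∀ w : Fin n → ℕ, Metric.ediam (t n w) ^ s ≤
        ENNReal.ofReal (Real.exp (-κ * C) ^ n) * ∏ i, f (w i) := by
      intro w
      rcases (t n w).eq_empty_or_nonempty with h | h
      · rw [h, Metric.ediam_empty, ENNReal.zero_rpow_of_pos (by linarith)]
        exact zero_le
      · have hP := hprod n hn w h
        set P := ∏ i, (w i : ℝ) with hPdef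
        have hP0 : 0 < P := (Real.exp_pos _).trans_le hP
        calc Metric.ediam (t n w) ^ s ≤ ENNReal.ofReal (P ^ (-2 : ℝ)) ^ s := by
              gcongr
              exact hdiam n w
          _ = ENNReal.ofReal (P ^ (-κ) * P ^ (-2 * σ)) := by
              rw [ENNReal.ofReal_rpow_of_pos (by positivity), ← Real.rpow_mul hP0.le,
                ← Real.rpow_add hP0]
              congr 2
              rw [hκ]
              ring
          _ ≤ ENNReal.ofReal (Real.exp (-κ * C) ^ n * P ^ (-2 * σ)) := by
              gcongr
              calc P ^ (-κ) ≤ Real.exp (C * n) ^ (-κ) :=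
                    Real.rpow_le_rpow_of_nonpos (Real.exp_pos _) hP (by linarith)
                _ = _ := by
                    rw [← Real.exp_mul, ← Real.exp_nat_mul]
                    congr 1
                    ring
          _ = _ := by
              rw [ENNReal.ofReal_mul (by positivity), hPdef,
                ← Real.finsetProd_rpow _ _ (fun i _ => by positivity),
                ENNReal.ofReal_prod_of_nonneg (fun i _ => by positivity)]
    calc ∑' w, Metric.ediam (t n w) ^ s
        ≤ ∑' w : Fin n → ℕ, ENNReal.ofReal (Real.exp (-κ * C) ^ n) * ∏ i, f (w i) :=
          ENNReal.tsum_le_tsum hterm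
      _ = ENNReal.ofReal ((Real.exp (-κ * C) * z) ^ n) := by
          rw [ENNReal.tsum_mul_left, ENNReal.tsum_prod_fin, hfz, mul_pow,
            ENNReal.ofReal_mul (by positivity), ENNReal.ofReal_pow hz0]
      _ ≤ 1 := by
          rw [ENNReal.ofReal_le_one]
          refine pow_le_one₀ (by positivity) ?_
          have h1 : -κ * C = -(2 * z + 1) := by
            rw [hC]
            field_simp
          rw [h1, Real.exp_neg, inv_mul_le_iff₀ (Real.exp_pos _)]
          linarith [Real.add_one_le_exp (2 * z + 1)]
  · rw [← ENNReal.ofReal_zero]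
    refine ENNReal.tendsto_ofReal (tendsto_pow_atTop_nhds_zero_of_lt_one (Real.exp_pos _).le ?_)
    rw [Real.exp_lt_one_iff]
    linarith
  · filter_upwards [eventually_ge_atTop N] with n hn w
    rcases (t n w).eq_empty_or_nonempty with h | h
    · rw [h, Metric.ediam_empty]
      exact zero_le
    · refine (hdiam n w).trans (ENNReal.ofReal_le_ofReal ?_)
      calc (∏ i, (w i : ℝ)) ^ (-2 : ℝ) ≤ Real.exp (C * n) ^ (-2 : ℝ) :=
            Real.rpow_le_rpow_of_nonpos (Real.exp_pos _) (hprod n hn w h) (by norm_num)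
        _ = _ := by
            rw [← Real.exp_mul, ← Real.exp_nat_mul]
            congr 1
            ring
  · filter_upwards with n x hx
    exact mem_iUnion.2 ⟨fun i => pq x (i + 1), hx, fun _ => rfl⟩

theorem rpow_bounds_of_logDeriv_bounds {ψ ψ' : ℝ → ℝ} {b α β : ℝ} (hb : 1 ≤ b)
    (hpos : ∀ x ≥ b, 0 < ψ x) (hd : ∀ x ≥ b, HasDerivAt ψ (ψ' x) x)
    (hα : ∀ x ≥ b, α ≤ x * ψ' x / ψ x) (hβ : ∀ x ≥ b, x * ψ' x / ψ x ≤ β) :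
    ∃ k > 0, ∃ K > 0, ∀ x ≥ b, k * x ^ α ≤ ψ x ∧ ψ x ≤ K * x ^ β := by
  have hder : ∀ γ : ℝ, ∀ x ≥ b, HasDerivAt (fun x => Real.log (ψ x) - γ * Real.log x)
      (ψ' x / ψ x - γ * x⁻¹) x := fun γ x hx =>
    ((hd x hx).log (hpos x hx).ne').sub
      ((Real.hasDerivAt_log (by linarith : x ≠ 0)).const_mul γ)
  have hcont : ∀ γ : ℝ, ContinuousOn (fun x => Real.log (ψ x) - γ * Real.log x) (Ici b) :=
    fun γ x hx => (hder γ x hx).continuousAt.continuousWithinAt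
  have hmono : MonotoneOn (fun x => Real.log (ψ x) - α * Real.log x) (Ici b) := by
    refine monotoneOn_of_deriv_nonneg (convex_Ici b) (hcont α)
      (fun x hx => ?_) fun x hx => ?_
    all_goals
      rw [interior_Ici] at hx
      have hx' : b ≤ x := le_of_lt hx
      have hx0 : 0 < x := by linarith
    · exact (hder α x hx').differentiableAt.differentiableWithinAt
    · rw [(hder α x hx').deriv]
      have h1 := hα x hx'
      have h2 : ψ' x / ψ x - α * x⁻¹ = (x * ψ' x / ψ x - α) * x⁻¹ := by
        have := (hpos x hx').ne'
        field_simp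
      rw [h2]
      exact mul_nonneg (by linarith) (by positivity)
  have hanti : AntitoneOn (fun x => Real.log (ψ x) - β * Real.log x) (Ici b) := by
    refine antitoneOn_of_deriv_nonpos (convex_Ici b) (hcont β)
      (fun x hx => ?_) fun x hx => ?_
    all_goals
      rw [interior_Ici] at hx
      have hx' : b ≤ x := le_of_lt hx
      have hx0 : 0 < x := by linarith
    · exact (hder β x hx').differentiableAt.differentiableWithinAt
    · rw [(hder β x hx').deriv]
      have h1 := hβ x hx'
      have h2 : ψ' x / ψ x - β * x⁻¹ = (x * ψ' x / ψ x - β) * x⁻¹ := by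
        have := (hpos x hx').ne'
        field_simp
      rw [h2]
      exact mul_nonpos_of_nonpos_of_nonneg (by linarith) (by positivity)
  refine ⟨_, Real.exp_pos (Real.log (ψ b) - α * Real.log b), _,
    Real.exp_pos (Real.log (ψ b) - β * Real.log b), fun x hx => ?_⟩
  have hx0 : 0 < x := by linarith
  have h1 := hmono self_mem_Ici hx hx
  have h2 := hanti self_mem_Ici hx hx
  simp only at h1 h2
  constructor
  · rw [Real.rpow_def_of_pos hx0, ← Real.exp_add, ← Real.le_log_iff_exp_le (hpos x hx)]
    linarith
  · rw [Real.rpow_def_of_pos hx0, ← Real.exp_add, ← Real.log_le_iff_le_exp (hpos x hx)]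
    linarith

theorem RegInc.exists_growth {ψ : ℝ → ℝ} {ρ : ℝ} (h : RegInc ψ ρ) (hρ0 : 1 / 2 < ρ)
    (hρ : ρ ≤ 1) :
    ∃ ε > (0 : ℝ), ∃ k > (0 : ℝ), ∃ K > (0 : ℝ), ∃ m : ℕ, ∀ n : ℕ, m ≤ n →
      k * (n : ℝ) ^ (1 / 2 + ε) ≤ ψ n ∧ ψ n ≤ K * (n : ℝ) ^ (5 / 4 : ℝ) ∧
      ψ ((n : ℝ) + 1) - ψ n ≤ K * ((n : ℝ) + 1) ^ ε ∧
      k / √((n : ℝ) + 1) ≤ ψ ((n : ℝ) + 1) - ψ n := by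
  obtain ⟨c, hc, ψ', hpos, hd, -, -, -, hlim⟩ := h
  set ε : ℝ := (ρ - 1 / 2) / 2 with hε
  have hε0 : 0 < ε := by linarith
  have hε1 : ε ≤ 1 / 4 := by linarith
  have hev := hlim.eventually (Icc_mem_nhds (by linarith : 1 / 2 + ε < ρ)
    (by linarith : ρ < 1 + ε))
  obtain ⟨b₀, hb₀⟩ := eventually_atTop.1 hev
  set b := max (max b₀ c) 1 with hb
  have hbb : b₀ ≤ b := (le_max_left _ _).trans (le_max_left _ _)
  have hbc : c ≤ b := (le_max_right _ _).trans (le_max_left _ _)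
  have hb1 : 1 ≤ b := le_max_right _ _
  have hα : ∀ x ≥ b, 1 / 2 + ε ≤ x * ψ' x / ψ x := fun x hx => (hb₀ x (hbb.trans hx)).1
  have hβ : ∀ x ≥ b, x * ψ' x / ψ x ≤ 1 + ε := fun x hx => (hb₀ x (hbb.trans hx)).2
  have hpos' : ∀ x ≥ b, 0 < ψ x := fun x hx => hpos x (hbc.trans hx)
  have hd' : ∀ x ≥ b, HasDerivAt ψ (ψ' x) x := fun x hx => hd x (hbc.trans hx)
  obtain ⟨k, hk, K, hK, hb⟩ := rpow_bounds_of_logDeriv_bounds hb1 hpos' hd' hα hβ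
  refine ⟨ε, hε0, k / 2, by positivity, 2 * K, by positivity, ⌈b⌉₊, fun n hn => ?_⟩
  have hbn : b ≤ n := (Nat.le_ceil b).trans (by exact_mod_cast hn)
  have hn1 : (1 : ℝ) ≤ n := hb1.trans hbn
  obtain ⟨h1, h2⟩ := hb n hbn
  have hmvt : ∃ y ∈ Ioo (n : ℝ) (n + 1), ψ' y = (ψ ((n : ℝ) + 1) - ψ n) / ((n : ℝ) + 1 - n) :=
    exists_hasDerivAt_eq_slope ψ ψ' (by linarith)
      (fun x hx => (hd' x (hbn.trans hx.1)).continuousAt.continuousWithinAt)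
      fun x hx => hd' x (hbn.trans hx.1.le)
  obtain ⟨y, ⟨hy1, hy2⟩, hy⟩ := hmvt
  have hby : b ≤ y := hbn.trans hy1.le
  have hy0 : 0 < y := by linarith
  have h3 : ψ ((n : ℝ) + 1) - ψ n = ψ' y := by rw [hy]; simp
  obtain ⟨h4, h5⟩ := hb y hby
  have h6 := hα y hby
  have h7 := hβ y hby
  have hψy := hpos' y hby
  rw [le_div_iff₀ hψy] at h6
  rw [div_le_iff₀ hψy] at h7
  refine ⟨?_, ?_, ?_, ?_⟩
  · refine le_trans ?_ h1
    gcongr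
    linarith
  · refine h2.trans ?_
    calc K * (n : ℝ) ^ (1 + ε) ≤ K * (n : ℝ) ^ (5 / 4 : ℝ) := by
          gcongr
          linarith
      _ ≤ _ := by
          gcongr
          linarith
  · rw [h3]
    have h8 : y * ψ' y ≤ y * (2 * K * y ^ ε) := by
      rw [Real.rpow_add hy0, Real.rpow_one] at h5
      calc y * ψ' y ≤ (1 + ε) * ψ y := h7
        _ ≤ 2 * ψ y := by gcongr; linarith
        _ ≤ 2 * (K * (y * y ^ ε)) := by gcongr
        _ = _ := by ring
    refine (le_of_mul_le_mul_left h8 hy0).trans ?_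
    gcongr
  · rw [h3]
    have h8 : y * (k / 2 / √y) ≤ y * ψ' y := by
      have h9 : √y ≤ y ^ (1 / 2 + ε) := by
        rw [Real.sqrt_eq_rpow]
        exact Real.rpow_le_rpow_of_exponent_le (by linarith) (by linarith)
      calc y * (k / 2 / √y) = 1 / 2 * (k * (y / √y)) := by ring
        _ = 1 / 2 * (k * √y) := by rw [Real.div_sqrt]
        _ ≤ 1 / 2 * (k * y ^ (1 / 2 + ε)) := by gcongr
        _ ≤ 1 / 2 * ψ y := by gcongr
        _ ≤ (1 / 2 + ε) * ψ y := by gcongr; linarith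
        _ ≤ _ := h6
    refine le_trans ?_ (le_of_mul_le_mul_left h8 hy0)
    gcongr

theorem Lmax_succ (x : ℝ) (n : ℕ) :
    Lmax x (n + 1) = max (Lmax x n) (pq x (n + 1) * pq x (n + 2)) := by
  rw [Lmax, ← Finset.insert_Icc_right_eq_Icc_add_one (by omega), Finset.sup_insert, sup_comm]
  rfl

theorem sq_le_add_of_max_recursion {L : ℕ → ℕ} {a : ℕ → ℕ} {m : ℕ} {B : ℕ → ℝ}
    (hL : ∀ n, L (n + 1) = max (L n) (a n * a (n + 1))) (ha : ∀ n, 1 ≤ a n) (hB0 : ∀ n, 0 ≤ B n)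
    (hL1 : ∀ n ≥ m, 1 ≤ L n) (hB : Monotone B)
    (hd : ∀ n ≥ m, Real.log (L (n + 1)) - Real.log (L n) ≤ B (n + 1)) (n : ℕ) (hn : m ≤ n) :
    Real.log (L n) ^ 2 ≤ Real.log (L m) ^ 2 +
      2 * B n * (∑ i ∈ Finset.range n, Real.log (a i) +
        ∑ i ∈ Finset.range (n + 1), Real.log (a i)) := by
  have hla : ∀ i, 0 ≤ Real.log (a i) := fun i => Real.log_natCast_nonneg _
  have hsum : ∀ n, 0 ≤ ∑ i ∈ Finset.range n, Real.log (a i) := fun n =>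
    Finset.sum_nonneg fun i _ => hla i
  induction n, hn using Nat.le_induction with
  | base =>
    have := mul_nonneg (mul_nonneg zero_le_two (hB0 m)) (add_nonneg (hsum m) (hsum (m + 1)))
    linarith
  | succ n hn ih =>
    have hstep : Real.log (L (n + 1)) ^ 2 - Real.log (L n) ^ 2 ≤
        2 * B (n + 1) * (Real.log (a n) + Real.log (a (n + 1))) := by
      have hnn := mul_nonneg (mul_nonneg zero_le_two (hB0 (n + 1)))
        (add_nonneg (hla n) (hla (n + 1)))
      rcases le_total (a n * a (n + 1)) (L n) with h | h
      · rw [hL, max_eq_left h, sub_self]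
        exact hnn
      · have h1 : Real.log (L (n + 1)) = Real.log (a n) + Real.log (a (n + 1)) := by
          rw [hL, max_eq_right h, Nat.cast_mul, Real.log_mul]
          · exact_mod_cast (Nat.one_le_iff_ne_zero.1 (ha n))
          · exact_mod_cast (Nat.one_le_iff_ne_zero.1 (ha (n + 1)))
        have h2 : Real.log (L n) ≤ Real.log (L (n + 1)) := by
          refine Real.log_le_log (by exact_mod_cast hL1 n hn) ?_
          rw [hL]
          exact_mod_cast le_max_left _ _
        have h3 : 0 ≤ Real.log (L n) := Real.log_natCast_nonneg _
        have h4 := hd n hn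
        rw [← h1]
        nlinarith
    have hmono := hB (Nat.le_succ n)
    have h5 := mul_le_mul_of_nonneg_right hmono (add_nonneg (hsum n) (hsum (n + 1)))
    rw [Finset.sum_range_succ _ (n + 1)]
    have h6 := Finset.sum_range_succ (fun i => Real.log (a i)) n
    have h7 : 2 * B (n + 1) * (∑ i ∈ Finset.range (n + 1), Real.log (a i) +
        (∑ i ∈ Finset.range (n + 1), Real.log (a i) + Real.log (a (n + 1)))) =
        2 * (B (n + 1) * (∑ i ∈ Finset.range n, Real.log (a i) +
          ∑ i ∈ Finset.range (n + 1), Real.log (a i))) +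
        2 * B (n + 1) * (Real.log (a n) + Real.log (a (n + 1))) := by
      rw [h6]
      ring
    rw [h7]
    linarith

theorem eventually_exp_le_prod_pq {φ : ℝ → ℝ} (hφpos : ∀ x > (0 : ℝ), 0 < φ x) {ε k K : ℝ}
    {m : ℕ} (hε : 0 < ε) (hk : 0 < k) (hK : 0 < K)
    (hlow : ∀ n : ℕ, m ≤ n → k * (n : ℝ) ^ (1 / 2 + ε) ≤ Real.log (φ n))
    (hdiff : ∀ n : ℕ, m ≤ n →
      Real.log (φ ((n : ℝ) + 1)) - Real.log (φ n) ≤ K * ((n : ℝ) + 1) ^ ε)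
    {x : ℝ} (hx : x ∈ Lset fun n : ℕ => φ n) (C : ℝ) :
    ∀ᶠ n : ℕ in atTop, Real.exp (C * n) ≤ ∏ i ∈ Finset.range n, (pq x (i + 1) : ℝ) := by
  obtain ⟨hx01, hxi, hlim⟩ := hx
  have horb := isOrbit_gaussMap hx01 hxi
  have ha : ∀ i, 1 ≤ pq x (i + 1) := horb.pos
  have hev := hlim.eventually (Icc_mem_nhds (by norm_num : (1 / 2 : ℝ) < 1) one_lt_two)
  obtain ⟨m₁, hm₁⟩ := eventually_atTop.1 hev
  set M := max (max m m₁) 1 with hM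
  have hMm : m ≤ M := (le_max_left _ _).trans (le_max_left _ _)
  have hMm₁ : m₁ ≤ M := (le_max_right _ _).trans (le_max_left _ _)
  have hM1 : 1 ≤ M := le_max_right _ _
  have hφ : ∀ n ≥ M, 0 < φ (n : ℕ) := fun n hn => hφpos _ (by exact_mod_cast hM1.trans hn)
  have hLφ : ∀ n ≥ M, 1 / 2 * φ (n : ℕ) ≤ Lmax x n ∧ Lmax x n ≤ 2 * φ (n : ℕ) := by
    intro n hn
    obtain ⟨h1, h2⟩ := hm₁ n (hMm₁.trans hn)
    rw [le_div_iff₀ (hφ n hn)] at h1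
    rw [div_le_iff₀ (hφ n hn)] at h2
    exact ⟨h1, h2⟩
  have hL1 : ∀ n ≥ M, 1 ≤ Lmax x n := by
    intro n hn
    have h1 := hLφ n hn
    have h2 := hφ n hn
    have : (0 : ℝ) < Lmax x n := by linarith
    exact_mod_cast this
  have hT : ∀ n ≥ M, Real.log (φ (n : ℕ)) - 1 ≤ Real.log (Lmax x n) ∧
      Real.log (Lmax x n) ≤ Real.log (φ (n : ℕ)) + 1 := by
    intro n hn
    have h1 := hLφ n hn
    have h2 := hφ n hn
    have h3 := Real.log_le_log (by positivity) h1.1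
    have h4 := Real.log_le_log (by linarith) h1.2
    rw [Real.log_mul (by norm_num) h2.ne', one_div, Real.log_inv] at h3
    rw [Real.log_mul (by norm_num) h2.ne'] at h4
    constructor <;> linarith [Real.log_two_lt_d9]
  set Q : ℕ → ℝ := fun n => ∑ i ∈ Finset.range n, Real.log (pq x (i + 1)) with hQ
  have hQsucc : ∀ n, Q n ≤ Q (n + 1) := fun n => by
    simp only [hQ, Finset.sum_range_succ]
    linarith [Real.log_natCast_nonneg (pq x (n + 1))]
  set K' := K + 2 with hK'
  have hsq : ∀ n ≥ M, Real.log (Lmax x n) ^ 2 ≤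
      Real.log (Lmax x M) ^ 2 + 2 * (K' * (n : ℝ) ^ ε) * (Q n + Q (n + 1)) := by
    refine sq_le_add_of_max_recursion (a := fun i => pq x (i + 1)) (B := fun n => K' * (n : ℝ) ^ ε)
      (Lmax_succ x) ha (fun n => by positivity) hL1 (fun i j hij => ?_) fun n hn => ?_
    · simp only
      gcongr
    · have h1 := hdiff n (hMm.trans hn)
      have h2 := (hT n hn).1
      have h3 := (hT (n + 1) (by omega)).2
      have h4 : (1 : ℝ) ≤ ((n : ℝ) + 1) ^ ε := Real.one_le_rpow (by simp) hε.le
      push_cast at h3 ⊢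
      rw [hK']
      linarith
  have hpow : ∀ γ > (0 : ℝ), Tendsto (fun n : ℕ => (n : ℝ) ^ γ) atTop atTop := fun γ hγ =>
    (tendsto_rpow_atTop hγ).comp tendsto_natCast_atTop_atTop
  have hevQ : ∀ᶠ n : ℕ in atTop, |C| * ((n + 1 : ℕ) : ℝ) ≤ Q (n + 1) := by
    filter_upwards [eventually_ge_atTop M, (hpow (1 / 2 + ε) (by positivity)).eventually_ge_atTop
      (2 / k), (hpow ε hε).eventually_ge_atTop
      ((Real.log (Lmax x M) ^ 2 + 8 * K' * |C|) / (k ^ 2 / 4)), (hpow ε hε).eventually_ge_atTop 1]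
      with n hn h1 h2 h3
    have hn1 : (1 : ℝ) ≤ n := by exact_mod_cast hM1.trans hn
    have h4 := hsq n hn
    have h5 := (hT n hn).1
    have h6 := hlow n (hMm.trans hn)
    rw [div_le_iff₀' hk] at h1
    rw [div_le_iff₀' (by positivity)] at h2
    have h7 : k / 2 * (n : ℝ) ^ (1 / 2 + ε) ≤ Real.log (Lmax x n) := by linarith
    have h8 : (k / 2 * (n : ℝ) ^ (1 / 2 + ε)) ^ 2 ≤ Real.log (Lmax x n) ^ 2 := by gcongr
    have h9 : (k / 2 * (n : ℝ) ^ (1 / 2 + ε)) ^ 2 = k ^ 2 / 4 * (n : ℝ) ^ ε * (n * (n : ℝ) ^ ε) := by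
      have h10 : ((n : ℝ) ^ (1 / 2 + ε)) ^ 2 = n * ((n : ℝ) ^ ε * (n : ℝ) ^ ε) := by
        rw [← Real.rpow_natCast, ← Real.rpow_mul (by positivity),
          ← Real.rpow_add (by positivity)]
        conv_rhs => rw [← Real.rpow_one_add' (by positivity) (by positivity)]
        congr 1
        push_cast
        ring
      rw [mul_pow, h10]
      ring
    set y := (n : ℝ) ^ ε with hy
    set T := Real.log (Lmax x M) ^ 2 with hTdef
    have hT0 : 0 ≤ T := sq_nonneg _
    have hny : 1 ≤ n * y := by nlinarith
    have h11 : (T + 8 * K' * |C|) * (n * y) ≤ T + 4 * K' * y * Q (n + 1) := by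
      calc _ ≤ k ^ 2 / 4 * y * (n * y) := by gcongr
        _ ≤ T + 2 * (K' * y) * (Q n + Q (n + 1)) := by linarith
        _ ≤ T + 2 * (K' * y) * (Q (n + 1) + Q (n + 1)) := by
            have := hQsucc n
            gcongr
        _ = _ := by ring
    have h12 : T ≤ T * (n * y) := le_mul_of_one_le_right hT0 hny
    have h13 : 4 * K' * y * (2 * |C| * n) ≤ 4 * K' * y * Q (n + 1) := by linarith
    have h14 := le_of_mul_le_mul_left h13 (by positivity)
    push_cast
    nlinarith [abs_nonneg C]
  obtain ⟨N, hN⟩ := eventually_atTop.1 hevQ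
  filter_upwards [eventually_ge_atTop (N + 1)] with n hNn
  have hn := hN (n - 1) (by omega)
  rw [Nat.sub_add_cancel (by omega)] at hn
  have h1 : C * n ≤ Q n := (mul_le_mul_of_nonneg_right (le_abs_self C) n.cast_nonneg).trans hn
  have hpq0 : ∀ i, (0 : ℝ) < pq x (i + 1) := fun i => by exact_mod_cast ha i
  calc Real.exp (C * n) ≤ Real.exp (Q n) := Real.exp_le_exp.2 h1
    _ = _ := by
      rw [hQ, Real.exp_sum]
      exact Finset.prod_congr rfl fun i _ => Real.exp_log (hpq0 i)

theorem mul_dimH_le_dimH_image {g : ℝ → ℝ} {A : Set ℝ} {C s : NNReal} (hs : 0 < s)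
    (h : ∀ x ∈ A, ∀ y ∈ A, edist x y ≤ C * edist (g x) (g y) ^ (s : ℝ)) :
    s * dimH A ≤ dimH (g '' A) := by
  have hinj : InjOn g A := by
    intro x hx y hy hxy
    have := h x hx y hy
    rw [hxy, edist_self, ENNReal.zero_rpow_of_pos (by exact_mod_cast hs), mul_zero] at this
    exact edist_le_zero.1 this
  have hleft := hinj.leftInvOn_invFunOn
  have hhol : HolderOnWith C s (Function.invFunOn g A) (g '' A) := by
    rintro _ ⟨x, hx, rfl⟩ _ ⟨y, hy, rfl⟩
    rw [hleft hx, hleft hy]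
    exact h x hx y hy
  have := hhol.dimH_image_le hs
  rw [hleft.image_image] at this
  rw [mul_comm]
  exact (ENNReal.le_div_iff_mul_le (Or.inl (by exact_mod_cast hs.ne'))
    (Or.inl ENNReal.coe_ne_top)).1 this

/-- The remainders of the mixed radix expansion of `t` in bases `N`. -/
noncomputable def radixRem (N : ℕ → ℕ) (t : ℝ) : ℕ → ℝ
  | 0 => t
  | n + 1 => Int.fract (N n * radixRem N t n)

/-- The digits of the mixed radix expansion of `t` in bases `N`. -/
noncomputable def radixDigit (N : ℕ → ℕ) (t : ℝ) (n : ℕ) : ℕ := ⌊N n * radixRem N t n⌋₊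

theorem radixRem_mem {N : ℕ → ℕ} {t : ℝ} (ht : t ∈ Ico (0 : ℝ) 1) (n : ℕ) :
    radixRem N t n ∈ Ico (0 : ℝ) 1 := by
  cases n with
  | zero => exact ht
  | succ n => exact ⟨Int.fract_nonneg _, Int.fract_lt_one _⟩

theorem radixDigit_lt {N : ℕ → ℕ} (hN : ∀ i, 2 ≤ N i) {t : ℝ} (ht : t ∈ Ico (0 : ℝ) 1) (n : ℕ) :
    radixDigit N t n < N n := by
  have h := radixRem_mem (N := N) ht n
  have h2 : (0 : ℝ) < N n := by exact_mod_cast lt_of_lt_of_le two_pos (hN n)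
  rw [radixDigit, Nat.floor_lt (mul_nonneg h2.le h.1)]
  nlinarith [h.2]

theorem radixDigit_add_radixRem {N : ℕ → ℕ} {t : ℝ} (ht : t ∈ Ico (0 : ℝ) 1) (n : ℕ) :
    radixDigit N t n + radixRem N t (n + 1) = N n * radixRem N t n := by
  rw [radixDigit, radixRem, natCast_floor_eq_intCast_floor
    (mul_nonneg (Nat.cast_nonneg _) (radixRem_mem ht n).1), Int.floor_add_fract]

theorem prod_mul_sub_eq_of_radixDigit_eq {N : ℕ → ℕ} {t u : ℝ} (ht : t ∈ Ico (0 : ℝ) 1)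
    (hu : u ∈ Ico (0 : ℝ) 1) (n : ℕ) (h : ∀ i < n, radixDigit N t i = radixDigit N u i) :
    (∏ i ∈ Finset.range n, (N i : ℝ)) * (t - u) = radixRem N t n - radixRem N u n := by
  induction n with
  | zero => simp [radixRem]
  | succ n ih =>
    have h1 := ih fun i hi => h i (by omega)
    have h2 := radixDigit_add_radixRem (N := N) ht n
    have h3 := radixDigit_add_radixRem (N := N) hu n
    rw [← h n (by omega)] at h3
    rw [Finset.prod_range_succ]
    linear_combination N n * h1 - h2 + h3

theorem prod_mul_abs_sub_le_one {N : ℕ → ℕ} {t u : ℝ} (ht : t ∈ Ico (0 : ℝ) 1)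
    (hu : u ∈ Ico (0 : ℝ) 1) (n : ℕ) (h : ∀ i < n, radixDigit N t i = radixDigit N u i) :
    (∏ i ∈ Finset.range n, (N i : ℝ)) * |t - u| ≤ 1 := by
  have h1 := prod_mul_sub_eq_of_radixDigit_eq ht hu n h
  have h2 := radixRem_mem (N := N) ht n
  have h3 := radixRem_mem (N := N) hu n
  rw [← abs_of_nonneg (Finset.prod_nonneg fun i _ => (N i).cast_nonneg (α := ℝ)), ← abs_mul, h1,
    abs_le]
  constructor <;> linarith [h2.1, h2.2, h3.1, h3.2]

theorem exists_radixDigit_ne {N : ℕ → ℕ} (hN : ∀ i, 2 ≤ N i) {t u : ℝ} (ht : t ∈ Ico (0 : ℝ) 1)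
    (hu : u ∈ Ico (0 : ℝ) 1) (htu : t ≠ u) : ∃ n, radixDigit N t n ≠ radixDigit N u n := by
  by_contra! h
  have h0 : 0 < |t - u| := abs_pos.2 (sub_ne_zero.2 htu)
  obtain ⟨n, hn⟩ := pow_unbounded_of_one_lt (1 / |t - u|) (one_lt_two (α := ℝ))
  have h1 := prod_mul_abs_sub_le_one ht hu n fun i _ => h i
  have h2 : (2 : ℝ) ^ n ≤ ∏ i ∈ Finset.range n, (N i : ℝ) := by
    calc (2 : ℝ) ^ n = ∏ i ∈ Finset.range n, (2 : ℝ) := by simp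
      _ ≤ _ := Finset.prod_le_prod (fun _ _ => by norm_num) fun i _ => by exact_mod_cast hN i
  rw [div_lt_iff₀ h0] at hn
  nlinarith

theorem IsOrbit.le_abs_sub {a b H : ℕ → ℕ} {X Y : ℕ → ℝ} (hX : IsOrbit a X) (hY : IsOrbit b Y)
    (ha : ∀ i, 2 ≤ a i) (hb : ∀ i, 2 ≤ b i) (haH : ∀ i, a i < H i) (hbH : ∀ i, b i < H i)
    {n : ℕ} (hab : ∀ i < n, a i = b i) (hne : a n ≠ b n) :
    1 / 2 * (∏ i ∈ Finset.range (n + 1), (H i : ℝ)) ^ (-2 : ℝ) ≤ |X 0 - Y 0| := by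
  have hpos : ∀ i, 0 < X i * Y i := fun i => mul_pos (hX i).1 (hY i).1
  have hXY : ∀ i, (H i : ℝ)⁻¹ * (H i : ℝ)⁻¹ ≤ X i * Y i := by
    intro i
    have key : ∀ {c : ℕ → ℕ} {Z : ℕ → ℝ}, IsOrbit c Z → c i < H i → (H i : ℝ)⁻¹ ≤ Z i := by
      intro c Z hZ hc
      refine le_trans ?_ (hZ.inv_le i)
      have : (c i : ℝ) + 1 ≤ H i := by exact_mod_cast hc
      gcongr
    exact mul_le_mul (key hX (haH i)) (key hY (hbH i)) (by positivity) (hX i).1.le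
  have hhalf : ∀ {c : ℕ → ℕ} {Z : ℕ → ℝ}, IsOrbit c Z → (∀ i, 2 ≤ c i) → Z (n + 1) ≤ 1 / 2 := by
    intro c Z hZ hc
    refine (hZ.le_inv _).trans ?_
    rw [one_div]
    gcongr
    exact_mod_cast hc _
  have hn : 1 / 2 * (X n * Y n) ≤ |X n - Y n| := by
    have h1 : X n - Y n = -(((a n : ℝ) - b n) + (X (n + 1) - Y (n + 1))) * (X n * Y n) := by
      linear_combination Y n * (hX n).2.2 - X n * (hY n).2.2
    rw [h1, abs_mul, abs_of_pos (hpos n), abs_neg]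
    refine mul_le_mul_of_nonneg_right ?_ (hpos n).le
    have h2 : 1 ≤ |(a n : ℝ) - b n| := by
      have : (1 : ℤ) ≤ |(a n : ℤ) - b n| := Int.one_le_abs (sub_ne_zero.2 (by exact_mod_cast hne))
      exact_mod_cast this
    have h3 : |X (n + 1) - Y (n + 1)| ≤ 1 / 2 := by
      rw [abs_le]
      constructor <;> linarith [(hX (n + 1)).1, (hY (n + 1)).1, hhalf hX ha, hhalf hY hb]
    have h4 := abs_sub_abs_le_abs_sub ((a n : ℝ) - b n) (-(X (n + 1) - Y (n + 1)))
    rw [abs_neg, sub_neg_eq_add] at h4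
    linarith
  rw [hX.abs_sub_eq hY n hab]
  calc 1 / 2 * (∏ i ∈ Finset.range (n + 1), (H i : ℝ)) ^ (-2 : ℝ)
      = 1 / 2 * ∏ i ∈ Finset.range (n + 1), ((H i : ℝ)⁻¹ * (H i : ℝ)⁻¹) := by
        rw [Finset.prod_mul_distrib, Finset.prod_inv_distrib, Real.rpow_neg (by positivity),
          ← mul_inv, ← sq]
        norm_cast
    _ ≤ 1 / 2 * ∏ i ∈ Finset.range (n + 1), (X i * Y i) := by
        refine mul_le_mul_of_nonneg_left ?_ (by norm_num)
        exact Finset.prod_le_prod (fun i _ => by positivity) fun i _ => hXY i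
    _ = 1 / 2 * (X n * Y n) * ∏ i ∈ Finset.range n, (X i * Y i) := by
        rw [Finset.prod_range_succ]
        ring
    _ ≤ _ := by
        gcongr
        exact Finset.prod_nonneg fun i _ => (hpos i).le

theorem le_dimH_of_pq_mem_Ico {lo N : ℕ → ℕ} (hlo : ∀ i, 2 ≤ lo i) (hN : ∀ i, 2 ≤ N i)
    {s : NNReal} (hs : 0 < s) (hs1 : s ≤ 1) {C : ℝ} (hC : ∀ n : ℕ,
      (∏ i ∈ Finset.range (n + 1), ((lo i + N i : ℕ) : ℝ)) ^ (2 * s : ℝ) ≤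
        C * ∏ i ∈ Finset.range n, (N i : ℝ)) :
    (s : ℝ≥0∞) ≤ dimH {x | ∃ a X, IsOrbit a X ∧ X 0 = x ∧
      ∀ i, lo i ≤ a i ∧ a i < lo i + N i} := by
  have hex : ∀ t : ℝ, ∃ X, IsOrbit (fun i => lo i + radixDigit N t i) X := fun t =>
    exists_isOrbit _ fun i => (hlo i).trans (Nat.le_add_right _ _)
  choose X hX using hex
  have hC0 : 0 < C := by
    have h0 := hC 0
    simp only [Finset.range_zero, Finset.prod_empty, mul_one] at h0
    refine lt_of_lt_of_le ?_ h0
    refine Real.rpow_pos_of_pos (Finset.prod_pos fun i _ => ?_) _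
    have := hN i
    exact_mod_cast (by omega : 0 < lo i + N i)
  have hmain : ∀ t ∈ Ico (0 : ℝ) 1, ∀ u ∈ Ico (0 : ℝ) 1,
      |t - u| ≤ 2 * C * |X t 0 - X u 0| ^ (s : ℝ) := by
    intro t ht u hu
    rcases eq_or_ne t u with rfl | htu
    · rw [sub_self, abs_zero]
      positivity
    classical
    have hne := exists_radixDigit_ne hN ht hu htu
    set n := Nat.find hne with hn
    have hlt : ∀ i < n, radixDigit N t i = radixDigit N u i := fun i hi =>
      not_not.1 (Nat.find_min hne hi)
    have h1 := prod_mul_abs_sub_le_one ht hu n hlt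
    have h2 := (hX t).le_abs_sub (hX u) (H := fun i => lo i + N i)
      (fun i => (hlo i).trans (Nat.le_add_right _ _))
      (fun i => (hlo i).trans (Nat.le_add_right _ _))
      (fun i => Nat.add_lt_add_left (radixDigit_lt hN ht i) _)
      (fun i => Nat.add_lt_add_left (radixDigit_lt hN hu i) _)
      (n := n) (fun i hi => congrArg _ (hlt i hi))
      (fun h => Nat.find_spec hne (Nat.add_left_cancel h))
    have h3 := hC n
    set R := ∏ i ∈ Finset.range (n + 1), ((lo i + N i : ℕ) : ℝ) with hR
    set P := ∏ i ∈ Finset.range n, (N i : ℝ) with hP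
    have hP0 : 0 < P := Finset.prod_pos fun i _ => by
      exact_mod_cast lt_of_lt_of_le two_pos (hN i)
    have hR0 : 0 < R := Finset.prod_pos fun i _ => by
      have := hN i
      exact_mod_cast (by omega : 0 < lo i + N i)
    have hs0 : (0 : ℝ) < s := by exact_mod_cast hs
    have hs1' : (s : ℝ) ≤ 1 := by exact_mod_cast hs1
    have h4 : 1 / 2 * (C * P)⁻¹ ≤ |X t 0 - X u 0| ^ (s : ℝ) := by
      calc 1 / 2 * (C * P)⁻¹ ≤ (1 / 2 : ℝ) ^ (s : ℝ) * (R ^ (2 * s : ℝ))⁻¹ := by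
            refine mul_le_mul ?_ ?_ (by positivity) (by positivity)
            · simpa using Real.rpow_le_rpow_of_exponent_ge (by norm_num : (0 : ℝ) < 1 / 2)
                (by norm_num) hs1'
            · gcongr
        _ = (1 / 2 * R ^ (-2 : ℝ)) ^ (s : ℝ) := by
            rw [Real.mul_rpow (by norm_num) (by positivity), ← Real.rpow_mul hR0.le,
              ← Real.rpow_neg hR0.le]
            congr 2
            ring
        _ ≤ _ := by gcongr
    calc |t - u| ≤ 1 / P := by rwa [le_div_iff₀' hP0]
      _ = 2 * C * (1 / 2 * (C * P)⁻¹) := by field_simp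
      _ ≤ _ := by gcongr
  have hdim := mul_dimH_le_dimH_image (g := fun t => X t 0) (A := Ico (0 : ℝ) 1)
    (C := (2 * C).toNNReal) hs (by
      intro t ht u hu
      have h := ENNReal.ofReal_le_ofReal (hmain t ht u hu)
      rw [ENNReal.ofReal_mul (by positivity),
        ← ENNReal.ofReal_rpow_of_nonneg (abs_nonneg _) s.coe_nonneg] at h
      rw [edist_dist, edist_dist, Real.dist_eq, Real.dist_eq]
      exact h)
  rw [Real.dimH_of_nonempty_interior (by simp), Module.finrank_self, Nat.cast_one, mul_one] at hdim
  refine hdim.trans (dimH_mono ?_)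
  rintro _ ⟨t, ht, rfl⟩
  exact ⟨_, X t, hX t, rfl, fun i => ⟨Nat.le_add_right _ _,
    Nat.add_lt_add_left (radixDigit_lt hN ht i) _⟩⟩

theorem exists_consecutive_sum_eq {u : ℕ → ℝ} {k K : ℝ} {m : ℕ} (hk : 0 < k) (hK : 0 < K)
    (hu : Tendsto u atTop atTop) (hup : ∀ n : ℕ, m ≤ n → u n ≤ K * (n : ℝ) ^ (5 / 4 : ℝ))
    (hinc : ∀ n : ℕ, m ≤ n → k / √((n : ℝ) + 1) ≤ u (n + 1) - u n) :
    ∃ θ : ℕ → ℝ, (∀ n, 1 ≤ θ n) ∧ (∀ᶠ n in atTop, θ n + θ (n + 1) = u (n + 1)) ∧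
      ∃ c > 0, ∃ K' > 0, ∀ n : ℕ,
        c * √((n : ℝ) + 1) ≤ θ n ∧ θ n ≤ K' * ((n : ℝ) + 1) ^ (5 / 4 : ℝ) := by
  obtain ⟨n₁, hn₁⟩ := eventually_atTop.1 (hu.eventually_ge_atTop 2)
  set n₀ := max m n₁ with hn₀
  set w : ℕ → ℝ := fun n => u (max n n₀ + 1) with hw
  have hw1 : ∀ n, n₀ ≤ n → k / √((n : ℝ) + 2) ≤ w (n + 1) - w n := by
    intro n hn
    have := hinc (n + 1) (by omega)
    simp only [hw, max_eq_left hn, max_eq_left (hn.trans (Nat.le_succ n))]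
    push_cast at this
    rw [show (n : ℝ) + 2 = n + 1 + 1 by ring]
    exact this
  have hw0 : ∀ n, 0 ≤ w (n + 1) - w n := by
    intro n
    rcases le_or_gt n₀ n with hn | hn
    · exact le_trans (by positivity) (hw1 n hn)
    · simp only [hw, max_eq_right hn.le, max_eq_right (Nat.succ_le_of_lt hn), sub_self, le_refl]
  set A := w 0 / 2 with hA
  have hA1 : 1 ≤ A := by
    have : 2 ≤ w 0 := hn₁ _ (by omega)
    linarith
  let θ : ℕ → ℝ := fun n => n.rec A fun i t => w i - t
  have hθ0 : θ 0 = A := rfl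
  have hθs : ∀ n, θ (n + 1) = w n - θ n := fun n => rfl
  have hθ1 : θ 1 = A := (hθs 0).trans (by rw [hθ0, hA]; ring)
  have hθ2 : ∀ n, θ (n + 2) = θ n + (w (n + 1) - w n) := fun n => by
    rw [hθs, hθs]
    ring
  have hθA : ∀ n, A ≤ θ n := by
    intro n
    induction n using Nat.twoStepInduction with
    | zero => exact hθ0.ge
    | one => exact hθ1.ge
    | more n ih _ => rw [hθ2]; linarith [hw0 n]
  refine ⟨θ, fun n => hA1.trans (hθA n), ?_, ?_⟩
  · filter_upwards [eventually_ge_atTop n₀] with n hn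
    rw [hθs]
    simp only [hw, max_eq_left hn]
    ring
  set c := min (k / 2) (A / √((n₀ : ℝ) + 3)) with hc
  have hck : 2 * c ≤ k := by linarith [min_le_left (k / 2) (A / √((n₀ : ℝ) + 3))]
  have hcA : c * √((n₀ : ℝ) + 3) ≤ A := by
    rw [← le_div_iff₀ (by positivity)]
    exact min_le_right _ _
  have hc0 : 0 < c := lt_min (by positivity) (by positivity)
  have hsmall : ∀ n : ℕ, n ≤ n₀ + 2 → c * √((n : ℝ) + 1) ≤ A := by
    intro n hn
    refine le_trans ?_ hcA
    have : (n : ℝ) ≤ n₀ + 2 := by exact_mod_cast hn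
    exact mul_le_mul_of_nonneg_left (Real.sqrt_le_sqrt (by linarith)) hc0.le
  have hlow : ∀ n : ℕ, c * √((n : ℝ) + 1) ≤ θ n := by
    intro n
    induction n using Nat.twoStepInduction with
    | zero => exact (hsmall 0 (by omega)).trans (hθA 0)
    | one => exact (hsmall 1 (by omega)).trans (hθA 1)
    | more n ih _ =>
      rcases le_or_gt n₀ n with hn | hn
      · rw [hθ2]
        have h1 := hw1 n hn
        have h2 : √((n : ℝ) + 3) ≤ √((n : ℝ) + 1) + 2 / √((n : ℝ) + 2) := by
          have h3 : √((n : ℝ) + 3) - √((n : ℝ) + 1) ≤ 2 / √((n : ℝ) + 3) := by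
            rw [le_div_iff₀ (by positivity)]
            have h4 : (n : ℝ) + 1 ≤ √((n : ℝ) + 1) * √((n : ℝ) + 3) := by
              calc (n : ℝ) + 1 = √((n : ℝ) + 1) * √((n : ℝ) + 1) :=
                    (Real.mul_self_sqrt (by positivity)).symm
                _ ≤ _ := by gcongr; norm_num
            nlinarith [Real.mul_self_sqrt (by positivity : (0 : ℝ) ≤ (n : ℝ) + 3)]
          have h5 : 2 / √((n : ℝ) + 3) ≤ 2 / √((n : ℝ) + 2) := by gcongr; norm_num
          linarith
        have h6 : ((n + 2 : ℕ) : ℝ) + 1 = n + 3 := by push_cast; ring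
        rw [h6]
        calc c * √((n : ℝ) + 3) ≤ c * (√((n : ℝ) + 1) + 2 / √((n : ℝ) + 2)) := by gcongr
          _ = c * √((n : ℝ) + 1) + 2 * c / √((n : ℝ) + 2) := by ring
          _ ≤ θ n + k / √((n : ℝ) + 2) := by gcongr
          _ ≤ _ := by linarith
      · exact (hsmall (n + 2) (by omega)).trans (hθA (n + 2))
  refine ⟨c, hc0, K * ((n₀ : ℝ) + 1) ^ (5 / 4 : ℝ), by positivity, fun n => ⟨hlow n, ?_⟩⟩
  have h1 : θ n ≤ w n := by
    have := hθs n
    linarith [hθA (n + 1)]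
  refine h1.trans ((hup _ (by omega)).trans ?_)
  rw [mul_assoc, ← Real.mul_rpow (by positivity) (by positivity)]
  gcongr
  have : max n n₀ + 1 ≤ (n₀ + 1) * (n + 1) := by
    rcases max_cases n n₀ with h | h <;> rw [h.1] <;> nlinarith
  exact_mod_cast this

theorem mul_sqrt_le_two_mul_sum_sqrt (n : ℕ) :
    n * √(n : ℝ) ≤ 2 * ∑ i ∈ Finset.range n, √((i : ℝ) + 1) := by
  induction n with
  | zero => simp
  | succ n ih =>
    rw [Finset.sum_range_succ]
    push_cast
    have h1 : n * (√((n : ℝ) + 1) - √(n : ℝ)) ≤ √((n : ℝ) + 1) := by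
      have h2 : √(n : ℝ) ≤ √((n : ℝ) + 1) := Real.sqrt_le_sqrt (by linarith)
      have h3 := Real.mul_self_sqrt (n.cast_nonneg (α := ℝ))
      have h4 := Real.mul_self_sqrt (by positivity : (0 : ℝ) ≤ (n : ℝ) + 1)
      have h5 : (√((n : ℝ) + 1) - √(n : ℝ)) * √((n : ℝ) + 1) ≤ 1 := by
        nlinarith [Real.sqrt_nonneg (n : ℝ)]
      have h6 : 0 < √((n : ℝ) + 1) := by positivity
      nlinarith
    nlinarith

theorem exists_rpow_prod_le {θ : ℕ → ℝ} {c K : ℝ} (hc : 0 < c) (hK : 0 < K)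
    (hθ1 : ∀ n, 1 ≤ θ n) (hθ : ∀ n : ℕ,
      c * √((n : ℝ) + 1) ≤ θ n ∧ θ n ≤ K * ((n : ℝ) + 1) ^ (5 / 4 : ℝ))
    {H N : ℕ → ℕ} (hH : ∀ i, (H i : ℝ) ≤ 5 * Real.exp (θ i)) (hH0 : ∀ i, 0 < H i)
    (hN : ∀ i, Real.exp (θ i) / ((i : ℝ) + 1) ≤ N i) {r : ℝ} (hr0 : 0 ≤ r) (hr : r < 1) :
    ∃ C : ℝ, ∀ n : ℕ, (∏ i ∈ Finset.range (n + 1), (H i : ℝ)) ^ r ≤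
      C * ∏ i ∈ Finset.range n, (N i : ℝ) := by
  have hH0' : ∀ i, (0 : ℝ) < H i := fun i => by exact_mod_cast hH0 i
  have hN0 : ∀ i, (0 : ℝ) < N i := fun i => lt_of_lt_of_le (by positivity) (hN i)
  have hlogH : ∀ i, Real.log (H i) ≤ θ i + 2 := by
    intro i
    refine (Real.log_le_log (hH0' i) (hH i)).trans ?_
    rw [Real.log_mul (by norm_num) (Real.exp_pos _).ne', Real.log_exp]
    have : Real.log 5 ≤ 2 := by
      rw [Real.log_le_iff_le_exp (by norm_num)]
      have := Real.exp_one_gt_d9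
      have h2 : Real.exp 2 = Real.exp 1 * Real.exp 1 := by rw [← Real.exp_add]; norm_num
      nlinarith
    linarith
  have hlogN : ∀ i, θ i - Real.log ((i : ℝ) + 1) ≤ Real.log (N i) := by
    intro i
    have := Real.log_le_log (by positivity) (hN i)
    rwa [Real.log_div (Real.exp_pos _).ne' (by positivity), Real.log_exp] at this
  set D : ℕ → ℝ := fun n => r * ∑ i ∈ Finset.range (n + 1), Real.log (H i) -
    ∑ i ∈ Finset.range n, Real.log (N i) with hD
  have hDle : ∀ᶠ n in atTop, D n ≤ 0 := by
    have hlim : Tendsto (fun n : ℕ => (n : ℝ) ^ (1 / 4 : ℝ)) atTop atTop :=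
      (tendsto_rpow_atTop (by norm_num)).comp tendsto_natCast_atTop_atTop
    filter_upwards [eventually_ge_atTop 1, hlim.eventually_ge_atTop
      (4 * (K + 6) / ((1 - r) * (c / 2)))] with n hn1 hn
    have hn1' : (1 : ℝ) ≤ n := by exact_mod_cast hn1
    rw [div_le_iff₀' (by have := sub_pos.2 hr; positivity)] at hn
    set S := ∑ i ∈ Finset.range n, θ i with hS
    have h1 : ∑ i ∈ Finset.range (n + 1), Real.log (H i) ≤ S + θ n + 2 * ((n : ℝ) + 1) := by
      calc _ ≤ ∑ i ∈ Finset.range (n + 1), (θ i + 2) := Finset.sum_le_sum fun i _ => hlogH i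
        _ = _ := by
          rw [Finset.sum_add_distrib, Finset.sum_range_succ]
          simp
          ring
    have h2 : S - n * Real.log ((n : ℝ) + 1) ≤ ∑ i ∈ Finset.range n, Real.log (N i) := by
      calc _ = ∑ i ∈ Finset.range n, (θ i - Real.log ((n : ℝ) + 1)) := by
            rw [Finset.sum_sub_distrib]
            simp [hS]
        _ ≤ _ := by
          refine Finset.sum_le_sum fun i hi => le_trans ?_ (hlogN i)
          have : (i : ℝ) ≤ n := by exact_mod_cast (Finset.mem_range.1 hi).le
          gcongr
    have h3 : c / 2 * (n * √(n : ℝ)) ≤ S := by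
      have h4 := mul_sqrt_le_two_mul_sum_sqrt n
      calc c / 2 * (n * √(n : ℝ)) ≤ c / 2 * (2 * ∑ i ∈ Finset.range n, √((i : ℝ) + 1)) := by
            gcongr
        _ = ∑ i ∈ Finset.range n, c * √((i : ℝ) + 1) := by
            rw [← Finset.mul_sum]
            ring
        _ ≤ S := Finset.sum_le_sum fun i _ => (hθ i).1
    set y := (n : ℝ) ^ (1 / 4 : ℝ) with hy
    have hy1 : 1 ≤ y := Real.one_le_rpow hn1' (by norm_num)
    have hsqrt : √(n : ℝ) = y * y := by
      rw [hy, ← Real.rpow_add (by linarith), Real.sqrt_eq_rpow]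
      norm_num
    have h54 : ((n : ℝ) + 1) ^ (5 / 4 : ℝ) ≤ 4 * (n * y) := by
      calc ((n : ℝ) + 1) ^ (5 / 4 : ℝ) ≤ (2 * n : ℝ) ^ (5 / 4 : ℝ) := by gcongr; linarith
        _ = 2 ^ (5 / 4 : ℝ) * (n : ℝ) ^ (1 + 1 / 4 : ℝ) := by
            rw [Real.mul_rpow (by norm_num) (by positivity)]
            norm_num
        _ ≤ 2 ^ (2 : ℝ) * (n * y) := by
            rw [Real.rpow_add (by linarith), Real.rpow_one]
            gcongr <;> norm_num
        _ = _ := by norm_num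
    set z := ((n : ℝ) + 1) ^ (5 / 4 : ℝ) with hz
    have hz' : z = (n + 1) * ((n : ℝ) + 1) ^ (1 / 4 : ℝ) := by
      rw [hz, ← Real.rpow_one_add' (by positivity) (by norm_num)]
      norm_num
    have hlog : n * Real.log ((n : ℝ) + 1) ≤ 4 * z := by
      have h5 := Real.log_le_rpow_div (by positivity : (0 : ℝ) ≤ (n : ℝ) + 1)
        (by norm_num : (0 : ℝ) < 1 / 4)
      calc n * Real.log ((n : ℝ) + 1)
          ≤ (n + 1) * (((n : ℝ) + 1) ^ (1 / 4 : ℝ) / (1 / 4)) := by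
            refine mul_le_mul (by linarith) h5 (Real.log_nonneg (by linarith)) (by positivity)
        _ = _ := by rw [hz']; ring
    have hnz : (n : ℝ) + 1 ≤ z := by
      rw [hz']
      exact le_mul_of_one_le_right (by positivity) (Real.one_le_rpow (by linarith) (by norm_num))
    have hθn := (hθ n).2
    have hθn0 := hθ1 n
    calc D n ≤ r * (S + θ n + 2 * ((n : ℝ) + 1)) - (S - n * Real.log ((n : ℝ) + 1)) := by
          rw [hD]
          exact sub_le_sub (mul_le_mul_of_nonneg_left h1 hr0) h2
      _ ≤ (r * S + (θ n + 2 * ((n : ℝ) + 1))) - (S - n * Real.log ((n : ℝ) + 1)) := by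
          have : r * (θ n + 2 * ((n : ℝ) + 1)) ≤ θ n + 2 * ((n : ℝ) + 1) :=
            mul_le_of_le_one_left (by positivity) hr.le
          linarith
      _ ≤ (K + 6) * z - (1 - r) * S := by linarith
      _ ≤ (K + 6) * (4 * (n * y)) - (1 - r) * (c / 2 * (n * √(n : ℝ))) := by
          have := sub_pos.2 hr
          gcongr
      _ = n * y * (4 * (K + 6) - (1 - r) * (c / 2) * y) := by rw [hsqrt]; ring
      _ ≤ 0 := mul_nonpos_of_nonneg_of_nonpos (by positivity) (by linarith)
  obtain ⟨B, hB⟩ := (isBoundedUnder_of_eventually_le hDle).bddAbove_range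
  refine ⟨Real.exp B, fun n => ?_⟩
  have h1 : D n ≤ B := hB ⟨n, rfl⟩
  have h2 : 0 < ∏ i ∈ Finset.range (n + 1), (H i : ℝ) := Finset.prod_pos fun i _ => hH0' i
  have h3 : 0 < ∏ i ∈ Finset.range n, (N i : ℝ) := Finset.prod_pos fun i _ => hN0 i
  rw [← Real.log_le_log_iff (by positivity) (by positivity), Real.log_rpow h2,
    Real.log_mul (Real.exp_pos _).ne' h3.ne', Real.log_exp,
    Real.log_prod fun i _ => (hH0' i).ne', Real.log_prod fun i _ => (hN0 i).ne']
  simp only [hD] at h1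
  linarith

theorem tendsto_div_of_max_recursion {L M : ℕ → ℕ} {f : ℕ → ℝ} {m : ℕ}
    (hL : ∀ n, L (n + 1) = max (L n) (M n)) (hmono : ∀ i j, m ≤ i → i ≤ j → f i ≤ f j)
    (hf : Tendsto f atTop atTop) (hM : Tendsto (fun n => (M n : ℝ) / f (n + 1)) atTop (nhds 1)) :
    Tendsto (fun n => (L n : ℝ) / f n) atTop (nhds 1) := by
  have hfpos : ∀ᶠ n in atTop, 0 < f n := hf.eventually_gt_atTop 0
  refine tendsto_order.2 ⟨fun a ha => ?_, fun a ha => ?_⟩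
  · suffices ∀ᶠ n in atTop, a < (L (n + 1) : ℝ) / f (n + 1) by
      obtain ⟨N, hN⟩ := eventually_atTop.1 this
      filter_upwards [eventually_ge_atTop (N + 1)] with n hn
      have := hN (n - 1) (by omega)
      rwa [Nat.sub_add_cancel (by omega)] at this
    filter_upwards [hM.eventually (lt_mem_nhds ha), (tendsto_add_atTop_nat 1).eventually hfpos]
      with n h1 h2
    refine h1.trans_le ?_
    gcongr
    rw [hL]
    exact le_max_right _ _
  · obtain ⟨b, hb1, hba⟩ := exists_between ha
    obtain ⟨N, hN⟩ := eventually_atTop.1 ((hM.eventually (gt_mem_nhds hb1)).and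
      ((tendsto_add_atTop_nat 1).eventually hfpos))
    set N' := max N m with hN'
    have hbound : ∀ n ≥ N', (L n : ℝ) ≤ max (L N' : ℝ) (b * f n) := by
      intro n hn
      induction n, hn using Nat.le_induction with
      | base => exact le_max_left _ _
      | succ n hn ih =>
        obtain ⟨h1, h2⟩ := hN n (by omega)
        rw [div_lt_iff₀ h2] at h1
        rw [hL, Nat.cast_max]
        refine max_le (ih.trans (max_le_max le_rfl ?_)) (h1.le.trans (le_max_right _ _))
        have := hmono n (n + 1) (by omega) (Nat.le_succ n)
        gcongr
    filter_upwards [eventually_ge_atTop N', hfpos, hf.eventually_ge_atTop (L N' : ℝ)]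
      with n h1 h2 h3
    rw [div_lt_iff₀ h2]
    refine (hbound n h1).trans_lt (max_lt (h3.trans_lt ?_) (by gcongr))
    exact lt_mul_of_one_lt_left h2 ha

theorem tendsto_div_exp_of_mem_Ico {θ : ℕ → ℝ} (hθ : Tendsto θ atTop atTop) {a : ℕ → ℕ}
    (hlo : ∀ i, ⌈Real.exp (θ i)⌉₊ ≤ a i)
    (hhi : ∀ i, a i < ⌈Real.exp (θ i)⌉₊ + (⌊Real.exp (θ i) / ((i : ℝ) + 1)⌋₊ + 2)) :
    Tendsto (fun i => (a i : ℝ) / Real.exp (θ i)) atTop (nhds 1) := by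
  have hlim : Tendsto (fun i : ℕ => 1 + (1 / ((i : ℝ) + 1) + 3 * Real.exp (-θ i))) atTop
      (nhds 1) := by
    have h1 := (tendsto_one_div_add_atTop_nhds_zero_nat (𝕜 := ℝ)).add
      ((Real.tendsto_exp_neg_atTop_nhds_zero.comp hθ).const_mul 3)
    simpa using h1.const_add 1
  refine tendsto_of_tendsto_of_tendsto_of_le_of_le tendsto_const_nhds hlim (fun i => ?_) fun i => ?_
  · simp only
    rw [le_div_iff₀ (Real.exp_pos _), one_mul]
    exact (Nat.le_ceil _).trans (by exact_mod_cast hlo i)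
  · simp only
    rw [div_le_iff₀ (Real.exp_pos _)]
    have h1 : (a i : ℝ) ≤ ⌈Real.exp (θ i)⌉₊ + (⌊Real.exp (θ i) / ((i : ℝ) + 1)⌋₊ + 2) := by
      exact_mod_cast (hhi i).le
    have h2 := Nat.ceil_lt_add_one (Real.exp_pos (θ i)).le
    have h3 := Nat.floor_le (by positivity : 0 ≤ Real.exp (θ i) / ((i : ℝ) + 1))
    have h4 : (1 + (1 / ((i : ℝ) + 1) + 3 * Real.exp (-θ i))) * Real.exp (θ i) =
        Real.exp (θ i) + Real.exp (θ i) / ((i : ℝ) + 1) + 3 := by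
      rw [Real.exp_neg]
      field_simp
      ring
    linarith

theorem half_le_dimH_Lset {φ : ℝ → ℝ} (hφpos : ∀ x > (0 : ℝ), 0 < φ x)
    (hφmono : MonotoneOn φ (Ioi (0 : ℝ))) {k K : ℝ} {m : ℕ} (hk : 0 < k) (hK : 0 < K)
    (hlim : Tendsto (fun n : ℕ => Real.log (φ n)) atTop atTop)
    (hup : ∀ n : ℕ, m ≤ n → Real.log (φ n) ≤ K * (n : ℝ) ^ (5 / 4 : ℝ))
    (hinc : ∀ n : ℕ, m ≤ n →
      k / √((n : ℝ) + 1) ≤ Real.log (φ ((n : ℝ) + 1)) - Real.log (φ n)) :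
    1 / 2 ≤ dimH (Lset fun n : ℕ => φ n) := by
  obtain ⟨θ, hθ1, hθsum, c, hc, K', hK', hθ⟩ := exists_consecutive_sum_eq hk hK hlim hup
    fun n hn => by simpa using hinc n hn
  have hθlim : Tendsto θ atTop atTop := by
    refine tendsto_atTop_mono (fun n => (hθ n).1) (Tendsto.const_mul_atTop hc ?_)
    exact Real.tendsto_sqrt_atTop.comp
      (tendsto_atTop_add_const_right _ 1 tendsto_natCast_atTop_atTop)
  set lo : ℕ → ℕ := fun i => ⌈Real.exp (θ i)⌉₊ with hlo
  set N : ℕ → ℕ := fun i => ⌊Real.exp (θ i) / ((i : ℝ) + 1)⌋₊ + 2 with hN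
  have hexp : ∀ i, 2 ≤ Real.exp (θ i) := fun i => by
    linarith [Real.add_one_le_exp (θ i), hθ1 i]
  have hsub : {x | ∃ a X, IsOrbit a X ∧ X 0 = x ∧ ∀ i, lo i ≤ a i ∧ a i < lo i + N i} ⊆
      Lset fun n : ℕ => φ n := by
    rintro _ ⟨a, X, hX, rfl, ha⟩
    refine ⟨⟨(hX 0).1, (hX 0).2.1⟩, hX.irrational, ?_⟩
    have h1 := tendsto_div_exp_of_mem_Ico hθlim (fun i => (ha i).1) fun i => (ha i).2
    refine tendsto_div_of_max_recursion (m := 1) (Lmax_succ (X 0)) (fun i j hi hij => ?_) ?_ ?_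
    · exact hφmono (mem_Ioi.2 (Nat.cast_pos.2 (by omega))) (mem_Ioi.2 (Nat.cast_pos.2 (by omega)))
        (by exact_mod_cast hij)
    · refine (Real.tendsto_exp_atTop.comp hlim).congr' ?_
      filter_upwards [eventually_ge_atTop 1] with n hn
      exact Real.exp_log (hφpos _ (by exact_mod_cast hn))
    · have h2 := h1.mul (h1.comp (tendsto_add_atTop_nat 1))
      rw [mul_one] at h2
      refine h2.congr' ?_
      filter_upwards [hθsum] with n hn
      have h3 : φ ((n + 1 : ℕ) : ℝ) = Real.exp (θ n) * Real.exp (θ (n + 1)) := by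
        rw [← Real.exp_add, hn, Real.exp_log (hφpos _ (by positivity))]
      rw [h3, hX.pq_eq, hX.pq_eq (n + 1), Nat.cast_mul, mul_div_mul_comm]
      rfl
  refine le_of_forall_lt_imp_le_of_dense fun d hd => ?_
  lift d to NNReal using hd.ne_top
  have hd2 : d < 1 / 2 := by
    have : (d : ℝ≥0∞) < ((1 / 2 : NNReal) : ℝ≥0∞) := by simpa using hd
    exact_mod_cast this
  rcases eq_or_ne d 0 with rfl | hd0
  · exact zero_le
  have hd2' : (d : ℝ) < 1 / 2 := by exact_mod_cast hd2
  have hlo2 : ∀ i, 2 ≤ lo i := fun i => by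
    have := (hexp i).trans (Nat.le_ceil _)
    exact_mod_cast this
  have hH : ∀ i, ((lo i + N i : ℕ) : ℝ) ≤ 5 * Real.exp (θ i) := fun i => by
    have h2 := Nat.ceil_lt_add_one (Real.exp_pos (θ i)).le
    have h3 := Nat.floor_le (by positivity : 0 ≤ Real.exp (θ i) / ((i : ℝ) + 1))
    have h4 : Real.exp (θ i) / ((i : ℝ) + 1) ≤ Real.exp (θ i) :=
      div_le_self (Real.exp_pos _).le (by simp)
    simp only [hlo, hN]
    push_cast
    linarith [hexp i]
  have hNle : ∀ i, Real.exp (θ i) / ((i : ℝ) + 1) ≤ N i := fun i => by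
    have h3 := Nat.lt_floor_add_one (Real.exp (θ i) / ((i : ℝ) + 1))
    simp only [hN]
    push_cast
    linarith
  obtain ⟨C, hC⟩ := exists_rpow_prod_le hc hK' hθ1 hθ (H := fun i => lo i + N i) (N := N)
    hH (fun i => by simp [hN]) hNle (r := 2 * d) (by positivity) (by linarith)
  exact (le_dimH_of_pq_mem_Ico hlo2 (fun i => by simp [hN])
    (pos_iff_ne_zero.2 hd0) (hd2.le.trans (by norm_num)) hC).trans (dimH_mono hsub)

/-- Theorem 1.2 (2): if `log φ` is regularly increasing with index `ρ ∈ (1/2, 1]`,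
then `dim_H L(φ) = 1/2`. -/
theorem statement1 (φ : ℝ → ℝ) (ρ : ℝ)
    (hφpos : ∀ x > (0 : ℝ), 0 < φ x)
    (hφmono : MonotoneOn φ (Ioi (0 : ℝ)))
    (hρ0 : 1 / 2 < ρ) (hρ : ρ ≤ 1)
    (hreg : RegInc (fun x => Real.log (φ x)) ρ) :
    dimH (Lset fun n : ℕ => φ n) = 1 / 2 := by
  obtain ⟨ε, hε, k, hk, K, hK, m, hgrowth⟩ := hreg.exists_growth hρ0 hρ
  refine le_antisymm ?_ ?_
  · refine (dimH_mono fun x hx => ?_).trans dimH_le_half_of_prod_pq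
    exact ⟨hx.1, hx.2.1, eventually_exp_le_prod_pq hφpos hε hk hK
      (fun n hn => (hgrowth n hn).1) (fun n hn => (hgrowth n hn).2.2.1) hx⟩
  · refine half_le_dimH_Lset hφpos hφmono hk hK ?_ (fun n hn => (hgrowth n hn).2.1)
      fun n hn => (hgrowth n hn).2.2.2
    obtain ⟨-, -, -, -, -, -, -, htop, -⟩ := hreg
    exact htop.comp tendsto_natCast_atTop_atTop
end
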